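/- arXiv:1007.3007 — 3 statements merged into one kernel-verified Lean document; each statement's English description precedes it below -/
import Mathlib

section
/- Let N ≥ 1 and let p satisfy 2 < p ≤ (2N−2)/(N−2) if N ≥ 3 and 2 < p < ∞ if N ≤ 2. Let B = (β_ij) be a symmetric 2×2 real matrix with β₁₁ ≥ 0 and β₂₂ ≥ 0. Then the system −Δu_i = ∑_{j=1}^2 β_ij u_j^{p/2} u_i^{p/2−1} with u₁, u₂ ≥ 0 on ℝ^N admits a nontrivial solution (a pair of C² nonnegative solutions, not both identically zero) if and only if B is not strictly copositive, i.e. if and only if one of the strict inequalities β₁₁ > 0, β₂₂ > 0, β₁₂ > −√(β₁₁β₂₂) fails. -/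
open Finset

/-- The Laplacian of a function `f : ℝ^N → ℝ`: the sum of the second partial
derivatives in the coordinate directions. -/
noncomputable def laplacian {N : ℕ} (f : (Fin N → ℝ) → ℝ) (x : Fin N → ℝ) : ℝ :=
  ∑ i : Fin N, fderiv ℝ (fun y => fderiv ℝ f y (Pi.single i 1)) x (Pi.single i 1)


theorem lv_contDiff_pd {N : ℕ} {f : (Fin N → ℝ) → ℝ} {n : ℕ∞} (hf : ContDiff ℝ (n + 1) f)
    (e : Fin N → ℝ) : ContDiff ℝ n (fun y => fderiv ℝ f y e) :=
  (hf.fderiv_right (m := n) le_rfl).clm_apply contDiff_const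

theorem lv_cont_lap {N : ℕ} {f : (Fin N → ℝ) → ℝ} (hf : ContDiff ℝ 2 f) :
    Continuous (laplacian f) := by
  unfold laplacian
  refine continuous_finsetSum _ fun i _ => ?_
  have h1 : ContDiff ℝ 1 (fun y => fderiv ℝ f y (Pi.single i 1)) :=
    lv_contDiff_pd (n := 1) (by norm_num; exact hf) _
  exact (lv_contDiff_pd (n := 0) (by norm_num; exact h1) _).continuous

open MeasureTheory in
theorem lv_ibp {N : ℕ} {w φ : (Fin N → ℝ) → ℝ} (hw : ContDiff ℝ 2 w) (hφ : ContDiff ℝ 2 φ)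
    (hc : HasCompactSupport φ) :
    ∫ x, laplacian w x * φ x = ∫ x, w x * laplacian φ x := by
  have hpd : ∀ (f : (Fin N → ℝ) → ℝ) (_ : ContDiff ℝ 2 f) (i : Fin N),
      ContDiff ℝ 1 (fun y => fderiv ℝ f y (Pi.single i 1)) := fun f hf i =>
    lv_contDiff_pd (n := 1) (by norm_num; exact hf) _
  have hpd2 : ∀ (f : (Fin N → ℝ) → ℝ) (_ : ContDiff ℝ 1 f) (i : Fin N),
      Continuous (fun y => fderiv ℝ f y (Pi.single i 1)) := fun f hf i =>
    (lv_contDiff_pd (n := 0) (by norm_num; exact hf) _).continuous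
  have hcs : ∀ i : Fin N, HasCompactSupport (fun y => fderiv ℝ φ y (Pi.single i 1)) :=
    fun i => hc.fderiv_apply (𝕜 := ℝ) _
  have hcs2 : ∀ i : Fin N, HasCompactSupport
      (fun x => fderiv ℝ (fun y => fderiv ℝ φ y (Pi.single i 1)) x (Pi.single i 1)) :=
    fun i => (hcs i).fderiv_apply (𝕜 := ℝ) _
  have h12 : (1 : WithTop ℕ∞) ≠ 0 := by norm_num
  have h22 : (2 : WithTop ℕ∞) ≠ 0 := by norm_num
  unfold laplacian
  simp only [Finset.sum_mul, Finset.mul_sum]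
  rw [integral_finsetSum, integral_finsetSum]
  · refine Finset.sum_congr rfl fun i _ => ?_
    have e1 := integral_mul_fderiv_eq_neg_fderiv_mul_of_integrable (𝕜 := ℝ) (μ := volume)
      (f := φ) (g := fun y => fderiv ℝ w y (Pi.single i 1)) (v := Pi.single i 1)
      (((hpd2 φ (hφ.of_le (by norm_num)) i).mul (hpd w hw i).continuous).integrable_of_hasCompactSupport
        ((hcs i).mul_right))
      ((hφ.continuous.mul (hpd2 _ (hpd w hw i) i)).integrable_of_hasCompactSupport hc.mul_right)
      ((hφ.continuous.mul (hpd w hw i).continuous).integrable_of_hasCompactSupport hc.mul_right)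
      (fun x _ => hφ.differentiable h22 x) (fun x _ => (hpd w hw i).differentiable h12 x)
    have e2 := integral_mul_fderiv_eq_neg_fderiv_mul_of_integrable (𝕜 := ℝ) (μ := volume)
      (f := w) (g := fun y => fderiv ℝ φ y (Pi.single i 1)) (v := Pi.single i 1)
      (((hpd2 w (hw.of_le (by norm_num)) i).mul (hpd φ hφ i).continuous).integrable_of_hasCompactSupport
        ((hcs i).mul_left))
      ((hw.continuous.mul (hpd2 _ (hpd φ hφ i) i)).integrable_of_hasCompactSupport (hcs2 i).mul_left)
      ((hw.continuous.mul (hpd φ hφ i).continuous).integrable_of_hasCompactSupport (hcs i).mul_left)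
      (fun x _ => hw.differentiable h22 x) (fun x _ => (hpd φ hφ i).differentiable h12 x)
    rw [e2]
    simp only [mul_comm] at e1 ⊢
    rw [e1]
  · intro i _
    exact (hw.continuous.mul (hpd2 _ (hpd φ hφ i) i)).integrable_of_hasCompactSupport (hcs2 i).mul_left
  · intro i _
    exact ((hpd2 _ (hpd w hw i) i).mul hφ.continuous).integrable_of_hasCompactSupport hc.mul_left

theorem lv_lap_scale {N : ℕ} {ψ : (Fin N → ℝ) → ℝ} (hψ : ContDiff ℝ 2 ψ) (r : ℝ) (x : Fin N → ℝ) :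
    laplacian (fun y => ψ (r • y)) x = r ^ 2 * laplacian ψ (r • x) := by
  unfold laplacian
  rw [Finset.mul_sum]
  refine Finset.sum_congr rfl fun i _ => ?_
  have key : ∀ (f : (Fin N → ℝ) → ℝ) (_ : Differentiable ℝ f) (y e : Fin N → ℝ),
      fderiv ℝ (fun y => f (r • y)) y e = r * fderiv ℝ f (r • y) e := by
    intro f hf y e
    have := ((hf (r • y)).hasFDerivAt).comp y ((hasFDerivAt_id (𝕜 := ℝ) y).const_smul r)
    have h2 : HasFDerivAt (fun y => f (r • y)) _ y := this
    rw [h2.fderiv]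
    simp
  have h1 : (fun y => fderiv ℝ (fun y => ψ (r • y)) y (Pi.single i 1)) =
      fun y => r * (fderiv ℝ ψ (r • y) (Pi.single i 1)) := by
    funext y
    exact key ψ (hψ.differentiable (by norm_num)) y _
  have hd : Differentiable ℝ (fun y => fderiv ℝ ψ y (Pi.single i 1)) :=
    (lv_contDiff_pd (n := 1) (by norm_num; exact hψ) _).differentiable (by norm_num)
  rw [h1, fderiv_const_mul]
  · have := key _ hd x (Pi.single i 1)
    simp only [smul_apply, smul_eq_mul, this]
    ring
  · have : Differentiable ℝ (fun y : Fin N → ℝ => r • y) := by fun_prop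
    exact (hd.comp this) x

theorem lv_lap_pow {N : ℕ} {f : (Fin N → ℝ) → ℝ} (hf : ContDiff ℝ 2 f) (m : ℕ) (x : Fin N → ℝ) :
    laplacian (fun y => f y ^ (m + 2)) x =
      f x ^ m * ∑ i : Fin N, (((m:ℝ) + 2) * (m + 1) * (fderiv ℝ f x (Pi.single i 1)) ^ 2
       + (m + 2) * f x * fderiv ℝ (fun y => fderiv ℝ f y (Pi.single i 1)) x (Pi.single i 1)) := by
  unfold laplacian
  rw [Finset.mul_sum]
  refine Finset.sum_congr rfl fun i _ => ?_
  have hfd : Differentiable ℝ f := hf.differentiable (by norm_num)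
  have hd : Differentiable ℝ (fun y => fderiv ℝ f y (Pi.single i 1)) :=
    (lv_contDiff_pd (n := 1) (by norm_num; exact hf) _).differentiable (by norm_num)
  have h1 : (fun y => fderiv ℝ (fun y => f y ^ (m + 2)) y (Pi.single i 1)) =
      fun y => ((m:ℝ) + 2) * (f y ^ (m + 1) * fderiv ℝ f y (Pi.single i 1)) := by
    funext y
    rw [((hfd y).hasFDerivAt.pow (m+2)).fderiv]
    simp
    ring
  rw [h1]
  have h3 := ((((hfd x).hasFDerivAt.pow (m+1)).mul (hd x).hasFDerivAt).const_mul ((m:ℝ)+2)).fderiv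
  have : fderiv ℝ (fun y => ((m:ℝ) + 2) * (f y ^ (m + 1) * fderiv ℝ f y (Pi.single i 1))) x = _ := h3
  rw [this]
  simp
  ring

theorem lv_test {N : ℕ} {q : ℝ} (hq : 1 < q) : ∃ (ψ : (Fin N → ℝ) → ℝ) (C : ℝ),
    ContDiff ℝ 2 ψ ∧ HasCompactSupport ψ ∧ (∀ x, 0 ≤ ψ x) ∧ (∀ x, ψ x ≤ 1) ∧ (∀ x, ‖x‖ < 1 → ψ x = 1) ∧
    0 ≤ C ∧ (∀ x, |laplacian ψ x| ≤ C * ψ x ^ (1 / q)) ∧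
    (∀ x, ‖x‖ < 1 → laplacian ψ x = 0) ∧ (∀ x, 2 < ‖x‖ → laplacian ψ x = 0) := by
  let f : ContDiffBump (0 : Fin N → ℝ) := ⟨1, 2, by norm_num, by norm_num⟩
  obtain ⟨m, hm⟩ := exists_nat_gt (2 / (q - 1))
  have hf : ContDiff ℝ 2 (f : (Fin N → ℝ) → ℝ) := f.contDiff
  have hfc : HasCompactSupport (f : (Fin N → ℝ) → ℝ) := f.hasCompactSupport
  let S : (Fin N → ℝ) → ℝ := fun x => ∑ i : Fin N, (((m:ℝ) + 2) * (m + 1) * (fderiv ℝ f x (Pi.single i 1)) ^ 2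
       + (m + 2) * f x * fderiv ℝ (fun y => fderiv ℝ f y (Pi.single i 1)) x (Pi.single i 1))
  have hpd : ∀ (i : Fin N),
      ContDiff ℝ 1 (fun y => fderiv ℝ f y (Pi.single i 1)) := fun i =>
    lv_contDiff_pd (n := 1) (by norm_num; exact hf) _
  have hpd2 : ∀ (i : Fin N),
      Continuous (fun x => fderiv ℝ (fun y => fderiv ℝ f y (Pi.single i 1)) x (Pi.single i 1)) := fun i =>
    (lv_contDiff_pd (n := 0) (by norm_num; exact hpd i) _).continuous
  have hS : Continuous S := by
    refine continuous_finsetSum _ fun i _ => ?_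
    have := (hpd i).continuous
    have := hpd2 i
    have := hf.continuous
    fun_prop
  obtain ⟨C, hC⟩ := (isCompact_closedBall (0 : Fin N → ℝ) 2).exists_bound_of_continuousOn hS.continuousOn
  have hC0 : 0 ≤ C := (norm_nonneg _).trans (hC 0 (by simp))
  have hψc : HasCompactSupport (fun y => f y ^ (m + 2)) := by
    refine hfc.comp_left (g := fun t => t ^ (m + 2)) (by simp)
  have hout : ∀ x : Fin N → ℝ, 2 < ‖x‖ → laplacian (fun y => f y ^ (m + 2)) x = 0 := by
    intro x hx
    rw [lv_lap_pow hf m x]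
    have : (f : (Fin N → ℝ) → ℝ) =ᶠ[nhds x] fun _ => 0 := by
      have : {y : Fin N → ℝ | 2 < ‖y‖} ∈ nhds x :=
        (isOpen_lt continuous_const continuous_norm).mem_nhds hx
      filter_upwards [this] with y hy
      exact f.zero_of_le_dist (by simpa using (le_of_lt hy))
    have h2 : fderiv ℝ f x = 0 := by rw [this.fderiv_eq]; simp
    simp [this.eq_of_nhds, h2]
  refine ⟨fun y => f y ^ (m + 2), C, hf.pow _, hψc, fun x => pow_nonneg f.nonneg _,
    fun x => pow_le_one₀ f.nonneg f.le_one, ?_, hC0, ?_, ?_, hout⟩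
  · intro x hx
    have : f x = 1 := f.one_of_mem_closedBall (by simpa using hx.le)
    simp [this]
  · intro x
    by_cases hx : ‖x‖ ≤ 2
    · rw [lv_lap_pow hf m x, abs_mul]
      have h1 : |∑ i : Fin N, (((m:ℝ) + 2) * (m + 1) * (fderiv ℝ f x (Pi.single i 1)) ^ 2
       + (m + 2) * f x * fderiv ℝ (fun y => fderiv ℝ f y (Pi.single i 1)) x (Pi.single i 1))| ≤ C :=
        hC x (by simpa using hx)
      have h0 : 0 ≤ f x := f.nonneg
      rw [mul_comm C]
      refine mul_le_mul ?_ h1 (abs_nonneg _) (Real.rpow_nonneg (pow_nonneg h0 _) _)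
      show |f x ^ m| ≤ (f x ^ (m + 2)) ^ (1 / q)
      rw [abs_of_nonneg (pow_nonneg h0 _), ← Real.rpow_natCast, ← Real.rpow_natCast, ← Real.rpow_mul h0]
      rcases h0.eq_or_lt with h | h
      · rw [← h]
        have : (0:ℝ) < m := lt_trans (div_pos two_pos (by linarith)) hm
        rw [Real.zero_rpow this.ne']
        positivity
      · refine Real.rpow_le_rpow_of_exponent_ge h f.le_one ?_
        rw [div_lt_iff₀ (by linarith)] at hm
        rw [mul_one_div, div_le_iff₀ (by linarith)]
        push_cast
        nlinarith
    · rw [hout x (by linarith [not_le.1 hx])]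
      simp only [abs_zero]
      exact mul_nonneg hC0 (Real.rpow_nonneg (pow_nonneg f.nonneg _) _)
  · intro x hx
    rw [lv_lap_pow hf m x]
    have : (f : (Fin N → ℝ) → ℝ) =ᶠ[nhds x] fun _ => 1 := by
      have : {y : Fin N → ℝ | ‖y‖ < 1} ∈ nhds x :=
        (isOpen_lt continuous_norm continuous_const).mem_nhds hx
      filter_upwards [this] with y hy
      exact f.one_of_mem_closedBall (by simpa using (le_of_lt hy))
    have h2 : (fun y => fderiv ℝ f y) =ᶠ[nhds x] fun _ => 0 := by
      have := this.fderiv (𝕜 := ℝ)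
      filter_upwards [this] with y hy
      rw [hy]; simp
    have h3 : ∀ i : Fin N, fderiv ℝ (fun y => fderiv ℝ f y (Pi.single i 1)) x = 0 := by
      intro i
      have : (fun y => fderiv ℝ f y (Pi.single i 1)) =ᶠ[nhds x] fun _ => 0 := by
        filter_upwards [h2] with y hy
        rw [hy]; simp
      rw [this.fderiv_eq]; simp
    simp [h2.eq_of_nhds, h3]

open MeasureTheory Filter Topology in
theorem lv_liouville {N : ℕ} {q c : ℝ} (hq : 1 < q) (hqN : N * (q - 1) ≤ 2 * q)
    (hc : 0 < c) {w : (Fin N → ℝ) → ℝ} (hw : ContDiff ℝ 2 w) (hw0 : ∀ x, 0 ≤ w x)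
    (hineq : ∀ x, c * w x ^ q ≤ -laplacian w x) : ∀ x, w x = 0 := by
  obtain ⟨ψ, C, hψ, hψc, hψ0, hψle1, hψ1, hC0, hψC, hin, hout⟩ := lv_test (N := N) hq
  set q' := q / (q - 1) with hq'
  have hconj : q.HolderConjugate q' := Real.HolderConjugate.conjExponent hq
  have hq'1 : 1 < q' := hconj.symm.lt
  have hwq : Continuous (fun x => w x ^ q) := hw.continuous.rpow_const (fun x => Or.inr (by linarith))
  have hwq0 : ∀ x, 0 ≤ w x ^ q := fun x => Real.rpow_nonneg (hw0 x) _
  -- main estimate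
  have main : ∀ μ : ℝ, 0 < μ → ∀ R : ℝ, 1 ≤ R →
      c * ∫ x, w x ^ q * ψ (R⁻¹ • x) ≤
        μ ^ q * (∫ x in {x | R ≤ ‖x‖}, w x ^ q * ψ (R⁻¹ • x)) + (C * μ⁻¹) ^ q' * 4 ^ N := by
    intro μ hμ R hR
    have hR0 : 0 < R := by linarith
    set φ : (Fin N → ℝ) → ℝ := fun x => ψ (R⁻¹ • x) with hφdef
    have hφ : ContDiff ℝ 2 φ := hψ.comp (contDiff_const_smul _)
    have hφc : HasCompactSupport φ := hψc.comp_smul (inv_ne_zero hR0.ne')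
    have hlap : ∀ x, laplacian φ x = (R⁻¹) ^ 2 * laplacian ψ (R⁻¹ • x) := lv_lap_scale hψ _
    have hi1 : Integrable (fun x => w x ^ q * φ x) :=
      (hwq.mul hφ.continuous).integrable_of_hasCompactSupport hφc.mul_left
    have hi2 : Integrable (fun x => laplacian w x * φ x) :=
      ((lv_cont_lap hw).mul hφ.continuous).integrable_of_hasCompactSupport hφc.mul_left
    have hms : MeasurableSet {x : Fin N → ℝ | R ≤ ‖x‖} := measurableSet_le measurable_const measurable_norm
    have hnorm : ∀ x : Fin N → ℝ, ‖R⁻¹ • x‖ = ‖x‖ / R := by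
      intro x; rw [norm_smul, Real.norm_of_nonneg (by positivity)]; ring
    have hlapc : HasCompactSupport (laplacian φ) := by
      refine HasCompactSupport.intro (isCompact_closedBall (0 : Fin N → ℝ) (2 * R)) ?_
      intro x hx
      rw [hlap, hout, mul_zero]
      rw [hnorm, lt_div_iff₀ hR0]
      simpa using hx
    have hi3 : Integrable (fun x => w x * laplacian φ x) :=
      (hw.continuous.mul (lv_cont_lap hφ)).integrable_of_hasCompactSupport hlapc.mul_left
    have s1 : c * ∫ x, w x ^ q * φ x ≤ - ∫ x, laplacian w x * φ x := by
      rw [← integral_const_mul, ← integral_neg]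
      refine integral_mono (hi1.const_mul c) hi2.neg ?_
      intro x
      have := mul_le_mul_of_nonneg_right (hineq x) (hψ0 (R⁻¹ • x))
      show c * (w x ^ q * ψ (R⁻¹ • x)) ≤ -(laplacian w x * ψ (R⁻¹ • x))
      linarith
    have hvol : volume.real (Metric.closedBall (0 : Fin N → ℝ) (2 * R)) = (4 * R) ^ N := by
      rw [measureReal_def, Real.volume_pi_closedBall _ (by positivity), ENNReal.toReal_ofReal (by positivity)]
      simp; ring
    set K : ℝ := (C * μ⁻¹ * R⁻¹ ^ 2) ^ q' with hK
    have hK0 : 0 ≤ K := by positivity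
    have hi4 : Integrable (fun x => Set.indicator {x : Fin N → ℝ | R ≤ ‖x‖} (fun x => μ ^ q * (w x ^ q * φ x)) x) :=
      (hi1.const_mul _).indicator hms
    have hi5 : Integrable (fun x => Set.indicator (Metric.closedBall (0 : Fin N → ℝ) (2 * R)) (fun _ => K) x) := by
      refine (integrable_indicator_iff measurableSet_closedBall).2 ?_
      exact integrableOn_const (isCompact_closedBall _ _).measure_lt_top.ne
    have s2 : - ∫ x, laplacian w x * φ x ≤ μ ^ q * (∫ x in {x | R ≤ ‖x‖}, w x ^ q * φ x) + K * (4 * R) ^ N := by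
      rw [lv_ibp hw hφ hφc, ← integral_neg, ← integral_const_mul, ← integral_indicator hms]
      have : K * (4 * R) ^ N = ∫ x, Set.indicator (Metric.closedBall (0 : Fin N → ℝ) (2 * R)) (fun _ => K) x := by
        rw [integral_indicator measurableSet_closedBall, setIntegral_const, hvol, smul_eq_mul, mul_comm]
      rw [this, ← integral_add hi4 hi5]
      refine integral_mono hi3.neg (hi4.add hi5) ?_
      intro x
      show -(w x * laplacian φ x) ≤ _ + _
      have hA : 0 ≤ Set.indicator {x : Fin N → ℝ | R ≤ ‖x‖} (fun x => μ ^ q * (w x ^ q * φ x)) x :=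
        Set.indicator_nonneg (fun x _ => mul_nonneg (by positivity) (mul_nonneg (hwq0 x) (hψ0 _))) x
      have hB : 0 ≤ Set.indicator (Metric.closedBall (0 : Fin N → ℝ) (2 * R)) (fun _ => K) x :=
        Set.indicator_nonneg (fun _ _ => hK0) x
      by_cases h1 : R ≤ ‖x‖
      · by_cases h2 : ‖x‖ ≤ 2 * R
        · rw [Set.indicator_of_mem (show x ∈ {x : Fin N → ℝ | R ≤ ‖x‖} from h1),
            Set.indicator_of_mem (show x ∈ Metric.closedBall (0 : Fin N → ℝ) (2 * R) by simpa using h2)]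
          set t := ψ (R⁻¹ • x) with ht
          have ht0 : 0 ≤ t := hψ0 _
          have e1 : -(w x * laplacian φ x) ≤ (μ * (w x * t ^ (1 / q))) * (C * μ⁻¹ * R⁻¹ ^ 2) := by
            rw [hlap]
            have : -(laplacian ψ (R⁻¹ • x)) ≤ C * t ^ (1 / q) := (neg_le_abs _).trans (hψC _)
            have h3 := mul_le_mul_of_nonneg_left this (mul_nonneg (hw0 x) (sq_nonneg R⁻¹))
            calc _ = w x * R⁻¹ ^ 2 * -(laplacian ψ (R⁻¹ • x)) := by ring
              _ ≤ _ := h3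
              _ = _ := by field_simp
          have e2 := Real.young_inequality_of_nonneg (a := μ * (w x * t ^ (1 / q))) (b := C * μ⁻¹ * R⁻¹ ^ 2)
            (mul_nonneg hμ.le (mul_nonneg (hw0 x) (Real.rpow_nonneg ht0 _))) (by positivity) hconj
          have e3 : (μ * (w x * t ^ (1 / q))) ^ q = μ ^ q * (w x ^ q * t) := by
            rw [Real.mul_rpow hμ.le (mul_nonneg (hw0 x) (Real.rpow_nonneg ht0 _)),
              Real.mul_rpow (hw0 x) (Real.rpow_nonneg ht0 _), ← Real.rpow_mul ht0,
              one_div_mul_cancel (by linarith), Real.rpow_one]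
          have e4 : 0 ≤ μ ^ q * (w x ^ q * t) := mul_nonneg (by positivity) (mul_nonneg (hwq0 x) ht0)
          have e5 : (μ * (w x * t ^ (1 / q))) ^ q / q ≤ μ ^ q * (w x ^ q * t) := by
            rw [e3]; exact div_le_self e4 hq.le
          have e6 : K / q' ≤ K := div_le_self hK0 hq'1.le
          show _ ≤ μ ^ q * (w x ^ q * t) + K
          linarith
        · rw [hlap, hout, mul_zero, mul_zero, neg_zero]
          · positivity
          · rw [hnorm, lt_div_iff₀ hR0]; exact not_le.1 h2
      · rw [hlap, hin, mul_zero, mul_zero, neg_zero]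
        · positivity
        · rw [hnorm, div_lt_one hR0]; exact not_le.1 h1
    have s3 : K * (4 * R) ^ N ≤ (C * μ⁻¹) ^ q' * 4 ^ N := by
      have hR2 : (R⁻¹ ^ 2) ^ q' * R ^ N ≤ 1 := by
        rw [← Real.rpow_natCast R N, inv_pow, ← Real.rpow_natCast R 2, ← Real.rpow_neg hR0.le,
          ← Real.rpow_mul hR0.le, ← Real.rpow_add hR0]
        refine Real.rpow_le_one_of_one_le_of_nonpos hR ?_
        have : (N:ℝ) ≤ 2 * q' := by
          rw [hq', ← mul_div_assoc, le_div_iff₀ (by linarith)]; exact hqN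
        push_cast
        linarith
      rw [hK, Real.mul_rpow (by positivity) (by positivity), mul_pow]
      calc _ = (C * μ⁻¹) ^ q' * 4 ^ N * ((R⁻¹ ^ 2) ^ q' * R ^ N) := by ring
        _ ≤ (C * μ⁻¹) ^ q' * 4 ^ N * 1 := by gcongr
        _ = _ := by ring
    linarith
  have hψle : ∀ R : ℝ, 1 ≤ R → Integrable (fun x => w x ^ q * ψ (R⁻¹ • x)) := by
    intro R hR
    have hφc : HasCompactSupport (fun x => ψ (R⁻¹ • x)) := hψc.comp_smul (inv_ne_zero (by linarith))
    exact (hwq.mul (hψ.continuous.comp (continuous_const_smul _))).integrable_of_hasCompactSupport hφc.mul_left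
  have hball : ∀ R : ℝ, 1 ≤ R → ∫ x in Metric.ball 0 R, w x ^ q ≤ ∫ x, w x ^ q * ψ (R⁻¹ • x) := by
    intro R hR
    rw [← integral_indicator measurableSet_ball]
    refine integral_mono_of_nonneg ?_ (hψle R hR) ?_
    · exact Filter.Eventually.of_forall fun x => Set.indicator_nonneg (fun x _ => hwq0 x) x
    · refine Filter.Eventually.of_forall fun x => ?_
      by_cases hx : x ∈ Metric.ball (0 : Fin N → ℝ) R
      · simp only [Set.indicator_of_mem hx]
        rw [hψ1, mul_one]
        rw [norm_smul, Real.norm_of_nonneg (by positivity), inv_mul_lt_iff₀ (by linarith)]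
        simpa using hx
      · simp only [Set.indicator_of_notMem hx]
        exact mul_nonneg (hwq0 x) (hψ0 _)
  have hr : Tendsto (fun n : ℕ => (n:ℝ) + 1) atTop atTop :=
    tendsto_atTop_add_const_right _ _ tendsto_natCast_atTop_atTop
  have hint : Integrable (fun x => w x ^ q) := by
    set μ := (c / 2) ^ (1 / q) with hμdef
    have hμ : 0 < μ := by positivity
    have hμq : μ ^ q = c / 2 := by
      rw [hμdef, ← Real.rpow_mul (by positivity), one_div_mul_cancel (by linarith), Real.rpow_one]
    refine (aecover_ball (x := (0 : Fin N → ℝ)) hr).integrable_of_integral_bounded_of_nonneg_ae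
      (2 / c * ((C * μ⁻¹) ^ q' * 4 ^ N)) ?_ (Filter.Eventually.of_forall hwq0) ?_
    · intro n
      exact (hwq.continuousOn.integrableOn_compact (isCompact_closedBall _ _)).mono_set
        Metric.ball_subset_closedBall
    · refine Filter.Eventually.of_forall fun n => ?_
      have hR : (1:ℝ) ≤ (n:ℝ) + 1 := by have := n.cast_nonneg (α := ℝ); linarith
      have h1 := main μ hμ _ hR
      have h2 := hball _ hR
      have h3 : ∫ x in {x : Fin N → ℝ | (n:ℝ) + 1 ≤ ‖x‖}, w x ^ q * ψ (((n:ℝ) + 1)⁻¹ • x) ≤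
          ∫ x, w x ^ q * ψ (((n:ℝ) + 1)⁻¹ • x) :=
        setIntegral_le_integral (hψle _ hR)
          (Filter.Eventually.of_forall fun x => mul_nonneg (hwq0 x) (hψ0 _))
      rw [hμq] at h1
      refine h2.trans ?_
      rw [div_mul_eq_mul_div, le_div_iff₀ hc]
      have := mul_le_mul_of_nonneg_left h3 (by positivity : 0 ≤ c / 2)
      linarith
  have htail : Tendsto (fun n : ℕ => ∫ x in {x : Fin N → ℝ | (n:ℝ) + 1 ≤ ‖x‖}, w x ^ q) atTop (𝓝 0) := by
    have h1 := (aecover_ball (x := (0 : Fin N → ℝ)) hr (μ := volume)).integral_tendsto_of_countably_generated hint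
    have h2 : ∀ n : ℕ, ∫ x in {x : Fin N → ℝ | (n:ℝ) + 1 ≤ ‖x‖}, w x ^ q =
        (∫ x, w x ^ q) - ∫ x in Metric.ball (0 : Fin N → ℝ) ((n:ℝ) + 1), w x ^ q := by
      intro n
      rw [← integral_add_compl (measurableSet_ball (x := (0 : Fin N → ℝ)) (ε := (n:ℝ) + 1)) hint]
      have : (Metric.ball (0 : Fin N → ℝ) ((n:ℝ) + 1))ᶜ = {x : Fin N → ℝ | (n:ℝ) + 1 ≤ ‖x‖} := by
        ext x; simp
      rw [this]; ring
    simp_rw [h2]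
    simpa using h1.const_sub (∫ x, w x ^ q)
  have hlim : ∀ μ : ℝ, 0 < μ → c * ∫ x, w x ^ q ≤ (C * μ⁻¹) ^ q' * 4 ^ N := by
    intro μ hμ
    have h1 := (aecover_ball (x := (0 : Fin N → ℝ)) hr (μ := volume)).integral_tendsto_of_countably_generated hint
    have h2 := (htail.const_mul (μ ^ q)).add_const ((C * μ⁻¹) ^ q' * 4 ^ N)
    rw [mul_zero, zero_add] at h2
    refine le_of_tendsto_of_tendsto' (h1.const_mul c) h2 fun n => ?_
    have hR : (1:ℝ) ≤ (n:ℝ) + 1 := by have := n.cast_nonneg (α := ℝ); linarith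
    refine (mul_le_mul_of_nonneg_left (hball _ hR) hc.le).trans ((main μ hμ _ hR).trans ?_)
    refine add_le_add_left (mul_le_mul_of_nonneg_left ?_ (by positivity)) _
    refine integral_mono (hψle _ hR).integrableOn hint.integrableOn fun x => ?_
    exact mul_le_of_le_one_right (hwq0 x) (hψle1 _)
  have hzero : ∫ x, w x ^ q = 0 := by
    have h0 : 0 ≤ ∫ x, w x ^ q := integral_nonneg hwq0
    have h1 : Tendsto (fun μ : ℝ => (C * μ⁻¹) ^ q' * 4 ^ N) atTop (𝓝 0) := by
      have h2 : Tendsto (fun μ : ℝ => C * μ⁻¹) atTop (𝓝 0) := by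
        simpa using tendsto_inv_atTop_zero.const_mul C
      have h3 := (h2.rpow_const (p := q') (Or.inr (by linarith))).mul_const ((4:ℝ) ^ N)
      rw [Real.zero_rpow (by linarith), zero_mul] at h3
      exact h3
    have h2 : c * ∫ x, w x ^ q ≤ 0 :=
      ge_of_tendsto h1 ((eventually_gt_atTop 0).mono fun μ hμ => hlim μ hμ)
    nlinarith
  have hae := (integral_eq_zero_iff_of_nonneg hwq0 hint).1 hzero
  have hall : (fun x => w x ^ q) = 0 := by
    exact (hwq.ae_eq_iff_eq volume continuous_zero).1 hae
  intro x
  have := congrFun hall x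
  exact ((Real.rpow_eq_zero (hw0 x) (by linarith)).1 this)

theorem lv_pointwise {r β1 β2 β12 : ℝ} (hr : 1 < r) (h1 : 0 < β1) (h2 : 0 < β2)
    (h12 : -Real.sqrt (β1 * β2) < β12) : ∃ k c : ℝ, 0 < k ∧ 0 < c ∧ ∀ x y : ℝ, 0 ≤ x → 0 ≤ y →
    c * (x + k * y) ^ (2 * r - 1) ≤ (β1 * x ^ r * x ^ (r - 1) + β12 * y ^ r * x ^ (r - 1)) +
      k * (β12 * x ^ r * y ^ (r - 1) + β2 * y ^ r * y ^ (r - 1)) := by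
  set t : ℝ := (Real.sqrt β2 / Real.sqrt β1) ^ (1 / r) with ht
  have hs1 : 0 < Real.sqrt β1 := Real.sqrt_pos.2 h1
  have hs2 : 0 < Real.sqrt β2 := Real.sqrt_pos.2 h2
  have ht0 : 0 < t := by positivity
  have htr : t ^ r = Real.sqrt β2 / Real.sqrt β1 := by
    rw [ht, ← Real.rpow_mul (by positivity), one_div_mul_cancel (by linarith), Real.rpow_one]
  have hb1 : Real.sqrt β1 ^ 2 = β1 := Real.sq_sqrt h1.le
  have hb2 : Real.sqrt β2 ^ 2 = β2 := Real.sq_sqrt h2.le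
  have htr1 : t ^ (r - 1) = t ^ r / t := Real.rpow_sub_one ht0.ne' r
  set γ := β12 / t ^ r with hγ
  have hγ1 : -β1 < γ := by
    rw [hγ, htr, lt_div_iff₀ (by positivity)]
    rw [Real.sqrt_mul h1.le] at h12
    have : β1 * (Real.sqrt β2 / Real.sqrt β1) = Real.sqrt β1 * Real.sqrt β2 := by
      field_simp; rw [hb1]
    linarith
  set δ := min β1 (β1 + γ) with hδ
  have hδ0 : 0 < δ := lt_min h1 (by linarith)
  have hD : 0 < (1 + 1 / t ^ 2) ^ (2 * r - 1) := by positivity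
  refine ⟨1 / t, δ / (1 + 1 / t ^ 2) ^ (2 * r - 1), by positivity, by positivity, ?_⟩
  intro x y hx hy
  obtain ⟨z, hz, rfl⟩ : ∃ z, 0 ≤ z ∧ y = z / t := ⟨t * y, by positivity, by field_simp⟩
  have hsplit : ∀ s : ℝ, 0 ≤ s → s ^ (2 * r - 1) = s ^ r * s ^ (r - 1) := by
    intro s hs
    rw [← Real.rpow_add' hs (by linarith)]; congr 1; ring
  have hcross : x ^ r * z ^ (r - 1) + z ^ r * x ^ (r - 1) ≤ x ^ r * x ^ (r - 1) + z ^ r * z ^ (r - 1) := by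
    rcases le_total x z with h | h
    · have a := Real.rpow_le_rpow hx h (by linarith : 0 ≤ r)
      have b := Real.rpow_le_rpow hx h (by linarith : 0 ≤ r - 1)
      nlinarith
    · have a := Real.rpow_le_rpow hz h (by linarith : 0 ≤ r)
      have b := Real.rpow_le_rpow hz h (by linarith : 0 ≤ r - 1)
      nlinarith
  have hc0 : 0 ≤ x ^ r * z ^ (r - 1) + z ^ r * x ^ (r - 1) := by positivity
  have hRHS : (β1 * x ^ r * x ^ (r - 1) + β12 * (z / t) ^ r * x ^ (r - 1)) +
      1 / t * (β12 * x ^ r * (z / t) ^ (r - 1) + β2 * (z / t) ^ r * (z / t) ^ (r - 1)) =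
      β1 * (x ^ r * x ^ (r - 1) + z ^ r * z ^ (r - 1)) + γ * (x ^ r * z ^ (r - 1) + z ^ r * x ^ (r - 1)) := by
    rw [Real.div_rpow hz ht0.le, Real.div_rpow hz ht0.le, htr1]
    have hβ : β2 = β1 * (t ^ r) ^ 2 := by
      rw [htr, div_pow, hb1, hb2]; field_simp
    rw [hβ, hγ]
    have : t ^ r ≠ 0 := by positivity
    field_simp
    ring
  rw [hRHS]
  have hlow : δ * (x ^ r * x ^ (r - 1) + z ^ r * z ^ (r - 1)) ≤
      β1 * (x ^ r * x ^ (r - 1) + z ^ r * z ^ (r - 1)) + γ * (x ^ r * z ^ (r - 1) + z ^ r * x ^ (r - 1)) := by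
    have hd1 : δ ≤ β1 := min_le_left _ _
    have hd2 : δ ≤ β1 + γ := min_le_right _ _
    have h0 : 0 ≤ x ^ r * x ^ (r - 1) + z ^ r * z ^ (r - 1) := by positivity
    rcases le_total 0 γ with hg | hg
    · nlinarith [mul_nonneg hg hc0]
    · nlinarith
  refine le_trans ?_ hlow
  rw [div_mul_eq_mul_div, mul_div_assoc]
  refine mul_le_mul_of_nonneg_left ?_ hδ0.le
  rw [div_le_iff₀ hD, ← hsplit x hx, ← hsplit z hz]
  have e : 1 / t * (z / t) = 1 / t ^ 2 * z := by field_simp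
  rw [e]
  have hmax : (x + 1 / t ^ 2 * z) ≤ (1 + 1 / t ^ 2) * max x z := by
    have := le_max_left x z
    have h3 := mul_le_mul_of_nonneg_left (le_max_right x z) (by positivity : 0 ≤ 1 / t ^ 2)
    linarith
  have hm0 : 0 ≤ max x z := le_max_of_le_left hx
  refine (Real.rpow_le_rpow (by positivity) hmax (by linarith)).trans ?_
  rw [Real.mul_rpow (by positivity) hm0, mul_comm]
  refine mul_le_mul_of_nonneg_right ?_ hD.le
  have := Real.rpow_nonneg hx (2 * r - 1)
  have := Real.rpow_nonneg hz (2 * r - 1)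
  rcases max_choice x z with h | h <;> rw [h] <;> linarith

theorem lv_lap_add {N : ℕ} {f g : (Fin N → ℝ) → ℝ} (hf : ContDiff ℝ 2 f) (hg : ContDiff ℝ 2 g) (k : ℝ)
    (x : Fin N → ℝ) : laplacian (fun y => f y + k * g y) x = laplacian f x + k * laplacian g x := by
  unfold laplacian
  rw [Finset.mul_sum, ← Finset.sum_add_distrib]
  refine Finset.sum_congr rfl fun i _ => ?_
  have hfd : Differentiable ℝ f := hf.differentiable (by norm_num)
  have hgd : Differentiable ℝ g := hg.differentiable (by norm_num)
  have hfd' : Differentiable ℝ (fun y => fderiv ℝ f y (Pi.single i 1)) :=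
    (lv_contDiff_pd (n := 1) (by norm_num; exact hf) _).differentiable (by norm_num)
  have hgd' : Differentiable ℝ (fun y => fderiv ℝ g y (Pi.single i 1)) :=
    (lv_contDiff_pd (n := 1) (by norm_num; exact hg) _).differentiable (by norm_num)
  have key : ∀ (f g : (Fin N → ℝ) → ℝ) (_ : Differentiable ℝ f) (_ : Differentiable ℝ g) (y e : Fin N → ℝ),
      fderiv ℝ (fun y => f y + k * g y) y e = fderiv ℝ f y e + k * fderiv ℝ g y e := by
    intro f g hf hg y e
    have : HasFDerivAt (fun y => f y + k * g y) _ y := (hf y).hasFDerivAt.add ((hg y).hasFDerivAt.const_mul k)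
    rw [this.fderiv]; simp
  have h1 : (fun y => fderiv ℝ (fun y => f y + k * g y) y (Pi.single i 1)) =
      fun y => fderiv ℝ f y (Pi.single i 1) + k * fderiv ℝ g y (Pi.single i 1) := by
    funext y; exact key f g hfd hgd y _
  rw [h1]
  exact key _ _ hfd' hgd' x _

theorem lv_nonexist (N : ℕ) (p : ℝ) (hp : 2 < p)
    (hpN : 3 ≤ N → p ≤ (2 * N - 2) / (N - 2))
    (B : Matrix (Fin 2) (Fin 2) ℝ) (hsym : B.IsSymm)
    (hB : 0 < B 0 0 ∧ 0 < B 1 1 ∧ -Real.sqrt (B 0 0 * B 1 1) < B 0 1)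
    (u : Fin 2 → (Fin N → ℝ) → ℝ) (hu : ∀ i, ContDiff ℝ 2 (u i)) (hu0 : ∀ i x, 0 ≤ u i x)
    (heq : ∀ i x, -laplacian (u i) x =
        ∑ j, B i j * (u j x) ^ (p / 2) * (u i x) ^ (p / 2 - 1)) : ∀ i, u i = 0 := by
  obtain ⟨k, c, hk, hc, h⟩ := lv_pointwise (r := p / 2) (by linarith) hB.1 hB.2.1 hB.2.2
  have hs : B 1 0 = B 0 1 := hsym.apply 0 1
  have hN : (N:ℝ) * ((p - 1) - 1) ≤ 2 * (p - 1) := by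
    by_cases h3 : 3 ≤ N
    · have := hpN h3
      have h3' : (3:ℝ) ≤ N := by exact_mod_cast h3
      rw [le_div_iff₀ (by linarith)] at this
      nlinarith
    · have : (N:ℝ) ≤ 2 := by exact_mod_cast (by omega : N ≤ 2)
      nlinarith
  have hw := lv_liouville (w := fun x => u 0 x + k * u 1 x) (q := p - 1) (by linarith) hN hc
    ((hu 0).add (contDiff_const.mul (hu 1)))
    (fun x => add_nonneg (hu0 0 x) (mul_nonneg hk.le (hu0 1 x))) (by
      intro x
      rw [lv_lap_add (hu 0) (hu 1)]
      have e0 := heq 0 x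
      have e1 := heq 1 x
      simp only [Fin.sum_univ_two, hs] at e0 e1
      have := h (u 0 x) (u 1 x) (hu0 0 x) (hu0 1 x)
      have e : 2 * (p / 2) - 1 = p - 1 := by ring
      rw [e] at this
      calc _ ≤ _ := this
        _ = _ := by rw [← e0, ← e1]; ring)
  have h01 : ∀ x, u 0 x = 0 ∧ u 1 x = 0 := by
    intro x
    have h1 := hw x
    have h2 := hu0 0 x
    have h3 := mul_nonneg hk.le (hu0 1 x)
    refine ⟨by linarith, ?_⟩
    have : k * u 1 x = 0 := by linarith
    exact (mul_eq_zero.1 this).resolve_left hk.ne'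
  intro i
  funext x
  fin_cases i
  · exact (h01 x).1
  · exact (h01 x).2

open Filter Topology in
theorem nr_tendsto {r a κ : ℝ} (hr : 1 < r) (hκ : 0 < κ) :
    Tendsto (fun s : ℝ => a * s ^ 2 - κ * s ^ (2 * r)) atTop atBot := by
  have h1 : Tendsto (fun s : ℝ => κ * s ^ (2 * r - 2) + -a) atTop atTop :=
    tendsto_atTop_add_const_right _ _ ((tendsto_rpow_atTop (by linarith)).const_mul_atTop hκ)
  have h2 := (tendsto_pow_atTop (α := ℝ) (n := 2) (by norm_num)).atTop_mul_atTop₀ h1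
  have h3 := tendsto_neg_atTop_atBot.comp h2
  refine h3.congr' ?_
  filter_upwards [eventually_gt_atTop 0] with s hs
  have : s ^ (2 * r) = s ^ 2 * s ^ (2 * r - 2) := by
    rw [← Real.rpow_natCast s 2, ← Real.rpow_add hs]; congr 1; push_cast; ring
  simp only [Function.comp]
  rw [this]; ring

theorem nr_bdd {r a κ : ℝ} (hr : 1 < r) (hκ : 0 < κ) :
    ∃ c : ℝ, 0 ≤ c ∧ ∀ s : ℝ, 0 ≤ s → a * s ^ 2 - κ * s ^ (2 * r) ≤ c := by
  obtain ⟨R, hR⟩ := (Filter.eventually_atTop.1 ((nr_tendsto (a := a) hr hκ).eventually_le_atBot 0))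
  have hcont : Continuous (fun s : ℝ => a * s ^ 2 - κ * s ^ (2 * r)) := by
    have : Continuous (fun s : ℝ => s ^ (2 * r)) := Real.continuous_rpow_const (by linarith)
    fun_prop
  obtain ⟨c, hc⟩ := (isCompact_Icc (a := (0:ℝ)) (b := R)).bddAbove_image hcont.continuousOn
  refine ⟨max c 0, le_max_right _ _, fun s hs => ?_⟩
  rcases le_total s R with h | h
  · exact le_max_of_le_left (hc ⟨s, ⟨hs, h⟩, rfl⟩)
  · exact le_max_of_le_right (hR s h)

theorem nr_coer {r a κ : ℝ} (hr : 1 < r) (hκ : 0 < κ) (c : ℝ) :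
    ∃ R : ℝ, 0 < R ∧ ∀ s t : ℝ, 0 ≤ s → 0 ≤ t →
      c ≤ a * s ^ 2 + a * t ^ 2 - κ * s ^ (2 * r) - κ * t ^ (2 * r) → s ≤ R ∧ t ≤ R := by
  obtain ⟨c1, hc1, hb⟩ := nr_bdd (a := a) hr hκ
  obtain ⟨R, hR⟩ := (Filter.eventually_atTop.1 ((nr_tendsto (a := a) hr hκ).eventually_le_atBot (c - c1 - 1)))
  refine ⟨max R 1, by positivity, fun s t hs ht h => ?_⟩
  have h1 := hb s hs
  have h2 := hb t ht
  constructor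
  · by_contra hcon
    have := hR s ((le_max_left _ _).trans (not_le.1 hcon).le)
    linarith
  · by_contra hcon
    have := hR t ((le_max_left _ _).trans (not_le.1 hcon).le)
    linarith

noncomputable def Jr (r a1 a2 q1 q2 q12 s t : ℝ) : ℝ :=
  s ^ 2 * a1 / 2 + t ^ 2 * a2 / 2 - (q1 * s ^ (2 * r) + q2 * t ^ (2 * r) - 2 * q12 * (s ^ r * t ^ r)) / (2 * r)

theorem Jr_swap (r a1 a2 q1 q2 q12 s t : ℝ) : Jr r a1 a2 q1 q2 q12 s t = Jr r a2 a1 q2 q1 q12 t s := by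
  unfold Jr; ring

theorem nr_sq {r s : ℝ} (hs : 0 ≤ s) : s ^ (2 * r) = (s ^ r) ^ 2 := by
  rw [mul_comm, Real.rpow_mul hs]; norm_num

theorem Jr_le {r a1 a2 q1 q2 q12 s t a κ l : ℝ} (hr : 1 < r) (hs : 0 ≤ s) (ht : 0 ≤ t)
    (h1 : a1 ≤ a) (h2 : a2 ≤ a) (hq : 0 ≤ q12) (hl : 0 < l) (k1 : q12 * l ≤ q1 - κ)
    (k2 : q12 / l ≤ q2 - κ) :
    Jr r a1 a2 q1 q2 q12 s t ≤ (a / 2) * s ^ 2 + (a / 2) * t ^ 2 - (κ / (2 * r)) * s ^ (2 * r)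
      - (κ / (2 * r)) * t ^ (2 * r) := by
  unfold Jr
  rw [nr_sq hs, nr_sq ht]
  set x := s ^ r
  set y := t ^ r
  have hxy : 2 * (x * y) ≤ l * x ^ 2 + y ^ 2 / l := by
    have : 0 ≤ (l * x - y) ^ 2 / l := by positivity
    have e : (l * x - y) ^ 2 / l = l * x ^ 2 + y ^ 2 / l - 2 * (x * y) := by field_simp; ring
    linarith
  have e1 := mul_le_mul_of_nonneg_left hxy hq
  have e2 := mul_le_mul_of_nonneg_right k1 (sq_nonneg x)
  have e3 := mul_le_mul_of_nonneg_right k2 (sq_nonneg y)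
  have e4 := mul_le_mul_of_nonneg_left h1 (sq_nonneg s)
  have e5 := mul_le_mul_of_nonneg_left h2 (sq_nonneg t)
  have e6 : κ * x ^ 2 + κ * y ^ 2 ≤ q1 * x ^ 2 + q2 * y ^ 2 - 2 * q12 * (x * y) := by
    have : q12 * (y ^ 2 / l) = q12 / l * y ^ 2 := by ring
    nlinarith
  have e7 := div_le_div_of_nonneg_right e6 (by linarith : 0 ≤ 2 * r)
  have e8 : (κ * x ^ 2 + κ * y ^ 2) / (2 * r) = κ / (2 * r) * x ^ 2 + κ / (2 * r) * y ^ 2 := by ring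
  linarith

theorem nr_lambda {q1 q2 q12 : ℝ} (h1 : 0 < q1) (h2 : 0 < q2) (h12 : 0 ≤ q12) (h : q12 ^ 2 < q1 * q2) :
    ∃ l κ : ℝ, 0 < l ∧ 0 < κ ∧ q12 * l ≤ q1 - κ ∧ q12 / l ≤ q2 - κ := by
  set l := Real.sqrt (q1 / q2) with hl
  have hl0 : 0 < l := Real.sqrt_pos.2 (by positivity)
  have hl2 : l ^ 2 = q1 / q2 := Real.sq_sqrt (by positivity)
  have a1 : q12 * l < q1 := by
    refine lt_of_pow_lt_pow_left₀ 2 h1.le ?_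
    rw [mul_pow, hl2, mul_div_assoc', div_lt_iff₀ h2]; nlinarith
  have a2 : q12 / l < q2 := by
    refine lt_of_pow_lt_pow_left₀ 2 h2.le ?_
    rw [div_pow, hl2, div_div_eq_mul_div, div_lt_iff₀ h1]; nlinarith
  exact ⟨l, min (q1 - q12 * l) (q2 - q12 / l), hl0, lt_min (by linarith) (by linarith),
    by linarith [min_le_left (q1 - q12 * l) (q2 - q12 / l)],
    by linarith [min_le_right (q1 - q12 * l) (q2 - q12 / l)]⟩

theorem Jr_cont {r : ℝ} (hr : 1 < r) : Continuous (fun z : ℝ × ℝ × ℝ × ℝ × ℝ × ℝ × ℝ =>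
    Jr r z.1 z.2.1 z.2.2.1 z.2.2.2.1 z.2.2.2.2.1 z.2.2.2.2.2.1 z.2.2.2.2.2.2) := by
  have h1 : Continuous (fun s : ℝ => s ^ (2 * r)) := Real.continuous_rpow_const (by linarith)
  have h2 : Continuous (fun s : ℝ => s ^ r) := Real.continuous_rpow_const (by linarith)
  unfold Jr
  have h3 : ∀ (g : ℝ × ℝ × ℝ × ℝ × ℝ × ℝ × ℝ → ℝ), Continuous g → Continuous (fun z => g z ^ (2 * r)) :=
    fun g hg => h1.comp hg
  have h4 : ∀ (g : ℝ × ℝ × ℝ × ℝ × ℝ × ℝ × ℝ → ℝ), Continuous g → Continuous (fun z => g z ^ r) :=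
    fun g hg => h2.comp hg
  have a1 := h3 (fun z => z.2.2.2.2.2.1) (by fun_prop)
  have a2 := h3 (fun z => z.2.2.2.2.2.2) (by fun_prop)
  have a3 := h4 (fun z => z.2.2.2.2.2.1) (by fun_prop)
  have a4 := h4 (fun z => z.2.2.2.2.2.2) (by fun_prop)
  fun_prop

/-- Tangent inequality on the Nehari set. -/
theorem Jr_tangent {r a1 a2 q1 q2 q12 s t : ℝ} (hr : 1 < r) (hs : 0 ≤ s) (ht : 0 ≤ t)
    (ha1 : 0 ≤ a1) (ha2 : 0 ≤ a2) (hq : 0 ≤ q12) (e1 : a1 + q12 = q1) (e2 : a2 + q12 = q2) :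
    Jr r a1 a2 q1 q2 q12 s t ≤ (1 / 2 - 1 / (2 * r)) * (a1 + a2) ∧
    (0 < q1 → q12 ^ 2 < q1 * q2 → Jr r a1 a2 q1 q2 q12 s t = (1 / 2 - 1 / (2 * r)) * (a1 + a2) →
      s = 1 ∧ t = 1) := by
  have key : ∀ s : ℝ, 0 ≤ s → s ^ 2 ≤ 1 + (s ^ (2 * r) - 1) / r ∧
      (s ≠ 1 → s ^ 2 < 1 + (s ^ (2 * r) - 1) / r) := by
    intro s hs
    have e : s ^ (2 * r) = (s ^ 2) ^ r := by
      rw [Real.rpow_mul hs]; norm_num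
    have hr0 : 0 < r := by linarith
    constructor
    · have := one_add_mul_self_le_rpow_one_add (s := s ^ 2 - 1) (by nlinarith [sq_nonneg s]) hr.le
      rw [add_sub_cancel, ← e] at this
      have h2 : (s ^ 2 - 1) ≤ (s ^ (2 * r) - 1) / r := by rw [le_div_iff₀ hr0]; nlinarith
      linarith
    · intro hne
      have hne2 : s ^ 2 - 1 ≠ 0 := by
        intro h
        have : (s - 1) * (s + 1) = 0 := by ring_nf; linarith
        rcases mul_eq_zero.1 this with h | h
        · exact hne (by linarith)
        · linarith
      have := one_add_mul_self_lt_rpow_one_add (s := s ^ 2 - 1) (by nlinarith [sq_nonneg s]) hne2 hr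
      rw [add_sub_cancel, ← e] at this
      have h2 : (s ^ 2 - 1) < (s ^ (2 * r) - 1) / r := by rw [lt_div_iff₀ hr0]; nlinarith
      linarith
  obtain ⟨ks, ks'⟩ := key s hs
  obtain ⟨kt, kt'⟩ := key t ht
  have hr0 : 0 < r := by linarith
  have hsq : 2 * (s ^ r * t ^ r) = s ^ (2 * r) + t ^ (2 * r) - (s ^ r - t ^ r) ^ 2 := by
    rw [nr_sq hs, nr_sq ht]; ring
  have id : (1 / 2 - 1 / (2 * r)) * (a1 + a2) - Jr r a1 a2 q1 q2 q12 s t =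
      a1 / 2 * (1 + (s ^ (2 * r) - 1) / r - s ^ 2) + a2 / 2 * (1 + (t ^ (2 * r) - 1) / r - t ^ 2)
      + q12 * (s ^ r - t ^ r) ^ 2 / (2 * r) := by
    unfold Jr
    have : 2 * q12 * (s ^ r * t ^ r) = q12 * (s ^ (2 * r) + t ^ (2 * r) - (s ^ r - t ^ r) ^ 2) := by
      rw [← hsq]; ring
    rw [this, ← e1, ← e2]
    field_simp
    ring
  have n1 : 0 ≤ a1 / 2 * (1 + (s ^ (2 * r) - 1) / r - s ^ 2) := mul_nonneg (by linarith) (by linarith)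
  have n2 : 0 ≤ a2 / 2 * (1 + (t ^ (2 * r) - 1) / r - t ^ 2) := mul_nonneg (by linarith) (by linarith)
  have n3 : 0 ≤ q12 * (s ^ r - t ^ r) ^ 2 / (2 * r) := by positivity
  refine ⟨by linarith, ?_⟩
  intro hq1 hdet heq
  have z1 : a1 / 2 * (1 + (s ^ (2 * r) - 1) / r - s ^ 2) = 0 := by linarith
  have z2 : a2 / 2 * (1 + (t ^ (2 * r) - 1) / r - t ^ 2) = 0 := by linarith
  have z3 : q12 * (s ^ r - t ^ r) ^ 2 / (2 * r) = 0 := by linarith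
  have f1 : 0 < a1 → s = 1 := by
    intro h
    by_contra hne
    have := ks' hne
    have : 0 < a1 / 2 * (1 + (s ^ (2 * r) - 1) / r - s ^ 2) := mul_pos (by linarith) (by linarith)
    linarith
  have f2 : 0 < a2 → t = 1 := by
    intro h
    by_contra hne
    have := kt' hne
    have : 0 < a2 / 2 * (1 + (t ^ (2 * r) - 1) / r - t ^ 2) := mul_pos (by linarith) (by linarith)
    linarith
  have f3 : 0 < q12 → s = t := by
    intro h
    have h1 : q12 * (s ^ r - t ^ r) ^ 2 = 0 := (div_eq_zero_iff.1 z3).resolve_right (by positivity)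
    have h2 := (mul_eq_zero.1 h1).resolve_left h.ne'
    have h3 : s ^ r = t ^ r := by have := pow_eq_zero_iff (two_ne_zero) |>.1 h2; linarith
    exact (Real.rpow_left_inj hs ht hr0.ne').1 h3
  rcases ha1.eq_or_lt with h | h
  · have hq12 : 0 < q12 := by linarith
    have ha2' : 0 < a2 := by
      rcases ha2.eq_or_lt with h' | h'
      · rw [← e1, ← e2, ← h, ← h'] at hdet; nlinarith
      · exact h'
    exact ⟨(f3 hq12).trans (f2 ha2'), f2 ha2'⟩
  · rcases ha2.eq_or_lt with h' | h'
    · have hq2 : 0 < q2 := by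
        by_contra hc
        have : q1 * q2 ≤ 0 := mul_nonpos_of_nonneg_of_nonpos hq1.le (not_lt.1 hc)
        nlinarith [sq_nonneg q12]
      have hq12 : 0 < q12 := by linarith
      exact ⟨f1 h, (f3 hq12).symm.trans (f1 h)⟩
    · exact ⟨f1 h, f2 h'⟩

theorem nr_small {r α κ γ : ℝ} (hr : 1 < r) (hα : 0 ≤ α) (hκ : 0 < κ) (hγ : 0 ≤ γ)
    (h : ∀ s : ℝ, 0 ≤ s → s ^ 2 * α - κ * s ^ (2 * r) + γ * s ^ r ≤ 0) : α = 0 ∧ γ = 0 := by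
  constructor
  · by_contra hne
    have hα' : 0 < α := lt_of_le_of_ne hα (Ne.symm hne)
    set s : ℝ := (α / (2 * κ)) ^ (1 / (2 * r - 2)) with hs
    have hs0 : 0 < s := by positivity
    have e : s ^ (2 * r - 2) = α / (2 * κ) := by
      rw [hs, ← Real.rpow_mul (by positivity), one_div_mul_cancel (by linarith), Real.rpow_one]
    have e2 : s ^ (2 * r) = s ^ 2 * (α / (2 * κ)) := by
      rw [← e, ← Real.rpow_natCast s 2, ← Real.rpow_add hs0]; congr 1; push_cast; ring
    have h1 := h s hs0.le
    have h2 : 0 ≤ γ * s ^ r := by positivity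
    have h3 : κ * s ^ (2 * r) = s ^ 2 * α / 2 := by rw [e2]; field_simp
    have h4 : 0 < s ^ 2 * α := by positivity
    linarith
  · by_contra hne
    have hγ' : 0 < γ := lt_of_le_of_ne hγ (Ne.symm hne)
    set s : ℝ := (γ / (2 * κ)) ^ (1 / r) with hs
    have hs0 : 0 < s := by positivity
    have e : s ^ r = γ / (2 * κ) := by
      rw [hs, ← Real.rpow_mul (by positivity), one_div_mul_cancel (by linarith), Real.rpow_one]
    have h1 := h s hs0.le
    rw [nr_sq hs0.le, e] at h1
    have h2 : 0 ≤ s ^ 2 * α := by positivity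
    have h3 : κ * (γ / (2 * κ)) ^ 2 = γ * (γ / (2 * κ)) / 2 := by field_simp
    have h4 : 0 < γ * (γ / (2 * κ)) := by positivity
    linarith

theorem Jr_zero {r : ℝ} (hr : 1 < r) (a1 a2 q1 q2 q12 t : ℝ) :
    Jr r a1 a2 q1 q2 q12 0 t = t ^ 2 * a2 / 2 - q2 * t ^ (2 * r) / (2 * r) := by
  unfold Jr
  rw [Real.zero_rpow (by linarith), Real.zero_rpow (by linarith)]; ring

theorem nr_pos {r a1 a2 q1 q2 q12 s0 t0 : ℝ} (hr : 1 < r) (ha1 : 0 ≤ a1) (ha2 : 0 ≤ a2)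
    (hq1 : 0 < q1) (hq2 : 0 < q2) (hq : 0 ≤ q12) (n1 : a1 = 0 → 0 < q12)
    (n3 : a1 = 0 → a2 = 0 → q1 * q2 < q12 ^ 2) (hdet : q12 ^ 2 < q1 * q2)
    (hs0 : 0 ≤ s0) (ht0 : 0 ≤ t0)
    (hmax : ∀ s t : ℝ, 0 ≤ s → 0 ≤ t → Jr r a1 a2 q1 q2 q12 s t ≤ Jr r a1 a2 q1 q2 q12 s0 t0) :
    0 < s0 := by
  have hr0 : 0 < r := by linarith
  rcases hs0.eq_or_lt with h | h
  swap
  · exact h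
  exfalso
  rw [← h] at hmax
  have key := nr_small (α := a1 / 2) (κ := q1 / (2 * r)) (γ := q12 * t0 ^ r / r) hr (by linarith)
    (by positivity) (by positivity) (fun s hs => by
      have := hmax s t0 hs ht0
      rw [Jr_zero hr] at this
      unfold Jr at this
      have e : (q1 * s ^ (2 * r) + q2 * t0 ^ (2 * r) - 2 * q12 * (s ^ r * t0 ^ r)) / (2 * r) =
        q1 / (2 * r) * s ^ (2 * r) + q2 * t0 ^ (2 * r) / (2 * r) - q12 * t0 ^ r / r * s ^ r := by
        field_simp
      rw [e] at this
      linarith)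
  have ha10 : a1 = 0 := by linarith [key.1]
  have hq12 := n1 ha10
  have ht : t0 ^ r = 0 := by
    have h2 := (div_eq_zero_iff.1 key.2).resolve_right hr0.ne'
    exact (mul_eq_zero.1 h2).resolve_left hq12.ne'
  have ht00 : t0 = 0 := (Real.rpow_eq_zero ht0 hr0.ne').1 ht
  rw [ht00] at hmax
  have key2 := nr_small (α := a2 / 2) (κ := q2 / (2 * r)) (γ := 0) hr (by linarith)
    (by positivity) le_rfl (fun t ht => by
      have := hmax 0 t le_rfl ht
      rw [Jr_zero hr, Jr_zero hr, Real.zero_rpow (by linarith)] at this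
      have e : q2 * t ^ (2 * r) / (2 * r) = q2 / (2 * r) * t ^ (2 * r) := by ring
      rw [e] at this
      have z : (0:ℝ) ^ 2 * a2 / 2 - q2 * 0 / (2 * r) = 0 := by ring
      rw [z] at this
      linarith)
  have := n3 ha10 (by linarith [key2.1])
  linarith

theorem nr_crit {r a1 a2 q1 q2 q12 s0 t0 : ℝ} (hr : 1 < r) (hs0 : 0 < s0) (ht0 : 0 ≤ t0)
    (hmax : ∀ s t : ℝ, 0 ≤ s → 0 ≤ t → Jr r a1 a2 q1 q2 q12 s t ≤ Jr r a1 a2 q1 q2 q12 s0 t0) :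
    s0 ^ 2 * a1 + q12 * (s0 ^ r * t0 ^ r) = q1 * s0 ^ (2 * r) := by
  have hr0 : 0 < r := by linarith
  have hd : HasDerivAt (fun s => Jr r a1 a2 q1 q2 q12 s t0)
      (2 * s0 * a1 / 2 - (q1 * (2 * r * s0 ^ (2 * r - 1)) - 2 * q12 * (r * s0 ^ (r - 1) * t0 ^ r)) / (2 * r)) s0 := by
    unfold Jr
    have h1 := Real.hasDerivAt_rpow_const (x := s0) (p := 2 * r) (Or.inl hs0.ne')
    have h2 := Real.hasDerivAt_rpow_const (x := s0) (p := r) (Or.inl hs0.ne')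
    have h3 := hasDerivAt_pow 2 s0
    have := ((((h3.mul_const a1).div_const 2).add_const (t0 ^ 2 * a2 / 2)).sub
      ((((h1.const_mul q1).add_const (q2 * t0 ^ (2 * r))).sub ((h2.mul_const (t0 ^ r)).const_mul (2 * q12))).div_const (2 * r)))
    refine this.congr_deriv ?_
    norm_num
  have hloc : IsLocalMax (fun s => Jr r a1 a2 q1 q2 q12 s t0) s0 := by
    filter_upwards [lt_mem_nhds hs0] with s hs
    exact hmax s t0 hs.le ht0
  have hz := hloc.hasDerivAt_eq_zero hd
  have e1 : s0 ^ (2 * r) = s0 ^ (2 * r - 1) * s0 := by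
    rw [Real.rpow_sub_one hs0.ne']; field_simp
  have e2 : s0 ^ r = s0 ^ (r - 1) * s0 := by
    rw [Real.rpow_sub_one hs0.ne']; field_simp
  rw [e1, e2]
  field_simp at hz
  linear_combination s0 * hz

theorem nr_det {r a1 a2 q1 q2 q12 M : ℝ} (hr : 1 < r) (ha1 : 0 ≤ a1) (ha2 : 0 ≤ a2)
    (hq1 : 0 < q1) (hq2 : 0 < q2) (hq : 0 ≤ q12)
    (n3 : a1 = 0 → a2 = 0 → q1 * q2 < q12 ^ 2)
    (hM : ∀ s t : ℝ, 0 ≤ s → 0 ≤ t → Jr r a1 a2 q1 q2 q12 s t ≤ M) :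
    q12 ^ 2 < q1 * q2 := by
  have hr0 : 0 < r := by linarith
  have hdet : q12 ^ 2 < q1 * q2 := by
    by_contra hcon
    have hcon := not_lt.1 hcon
    set c1 : ℝ := (Real.sqrt q2) ^ (1 / r) with hc1
    set c2 : ℝ := (Real.sqrt q1) ^ (1 / r) with hc2
    have p1 : 0 < Real.sqrt q1 := Real.sqrt_pos.2 hq1
    have p2 : 0 < Real.sqrt q2 := Real.sqrt_pos.2 hq2
    have r1 : c1 ^ r = Real.sqrt q2 := by
      rw [hc1, ← Real.rpow_mul (by positivity), one_div_mul_cancel (by linarith), Real.rpow_one]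
    have r2 : c2 ^ r = Real.sqrt q1 := by
      rw [hc2, ← Real.rpow_mul (by positivity), one_div_mul_cancel (by linarith), Real.rpow_one]
    have c1p : 0 < c1 := by positivity
    have c2p : 0 < c2 := by positivity
    set E1 := (c1 ^ 2 * a1 + c2 ^ 2 * a2) / 2 with hE1
    set E2 := (q12 * (Real.sqrt q1 * Real.sqrt q2) - q1 * q2) / r with hE2
    have hsq : (Real.sqrt q1 * Real.sqrt q2) ^ 2 = q1 * q2 := by
      rw [mul_pow, Real.sq_sqrt hq1.le, Real.sq_sqrt hq2.le]
    have hpp : 0 < Real.sqrt q1 * Real.sqrt q2 := by positivity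
    have hge : Real.sqrt q1 * Real.sqrt q2 ≤ q12 := by
      refine le_of_sq_le_sq ?_ hq
      rw [hsq]; exact hcon
    have hE1' : 0 ≤ E1 := by positivity
    have hE2' : 0 ≤ E2 := by
      refine div_nonneg ?_ hr0.le
      nlinarith
    have hE : 0 < E1 + E2 := by
      by_cases h1 : a1 = 0 ∧ a2 = 0
      · have h3 := n3 h1.1 h1.2
        have : Real.sqrt q1 * Real.sqrt q2 < q12 := by
          refine lt_of_pow_lt_pow_left₀ 2 hq ?_
          rw [hsq]; exact h3
        have : 0 < E2 := by
          refine div_pos ?_ hr0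
          nlinarith
        linarith
      · have : 0 < E1 := by
          by_cases h2 : a1 = 0
          · have : 0 < a2 := lt_of_le_of_ne ha2 (fun h => h1 ⟨h2, h.symm⟩)
            positivity
          · have : 0 < a1 := lt_of_le_of_ne ha1 (Ne.symm h2)
            positivity
        linarith
    set σ : ℝ := 1 + |M| / (E1 + E2) with hσ
    have hσ1 : 1 ≤ σ := by
      have : 0 ≤ |M| / (E1 + E2) := by positivity
      linarith
    have h1 := hM (σ * c1) (σ * c2) (by positivity) (by positivity)
    have e : Jr r a1 a2 q1 q2 q12 (σ * c1) (σ * c2) = σ ^ 2 * E1 + σ ^ (2 * r) * E2 := by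
      unfold Jr
      rw [Real.mul_rpow (by positivity) c1p.le, Real.mul_rpow (by positivity) c2p.le,
        Real.mul_rpow (by positivity) c1p.le, Real.mul_rpow (by positivity) c2p.le,
        nr_sq c1p.le, nr_sq c2p.le, r1, r2, Real.sq_sqrt hq1.le, Real.sq_sqrt hq2.le,
        nr_sq (by positivity : 0 ≤ σ), hE1, hE2]
      field_simp
      ring
    have h2 : σ ^ 2 ≤ σ ^ (2 * r) := by
      rw [← Real.rpow_natCast σ 2]
      exact Real.rpow_le_rpow_of_exponent_le hσ1 (by push_cast; linarith)
    have h3 : σ * (E1 + E2) = E1 + E2 + |M| := by rw [hσ]; field_simp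
    have h4 : σ ≤ σ ^ 2 := by nlinarith
    have h5 : M ≤ |M| := le_abs_self M
    rw [e] at h1
    nlinarith
  exact hdet

theorem nr_exists {r a1 a2 q1 q2 q12 M : ℝ} (hr : 1 < r) (ha1 : 0 ≤ a1) (ha2 : 0 ≤ a2)
    (hq1 : 0 < q1) (hq2 : 0 < q2) (hq : 0 ≤ q12) (n1 : a1 = 0 → 0 < q12) (n2 : a2 = 0 → 0 < q12)
    (n3 : a1 = 0 → a2 = 0 → q1 * q2 < q12 ^ 2)
    (hM : ∀ s t : ℝ, 0 ≤ s → 0 ≤ t → Jr r a1 a2 q1 q2 q12 s t ≤ M) :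
    q12 ^ 2 < q1 * q2 ∧ ∃ s0 t0 : ℝ, 0 < s0 ∧ 0 < t0 ∧
      s0 ^ 2 * a1 + q12 * (s0 ^ r * t0 ^ r) = q1 * s0 ^ (2 * r) ∧
      t0 ^ 2 * a2 + q12 * (s0 ^ r * t0 ^ r) = q2 * t0 ^ (2 * r) := by
  have hr0 : 0 < r := by linarith
  have hdet : q12 ^ 2 < q1 * q2 := nr_det hr ha1 ha2 hq1 hq2 hq n3 hM
  refine ⟨hdet, ?_⟩
  obtain ⟨l, κ, hl, hκ, k1, k2⟩ := nr_lambda hq1 hq2 hq hdet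
  obtain ⟨R, hR0, hR⟩ := nr_coer (a := max a1 a2 / 2) (κ := κ / (2 * r)) hr (by positivity) 0
  have hcont : Continuous (fun z : ℝ × ℝ => Jr r a1 a2 q1 q2 q12 z.1 z.2) :=
    (Jr_cont hr).comp (by fun_prop : Continuous fun z : ℝ × ℝ => (a1, a2, q1, q2, q12, z.1, z.2))
  have h0R : ((0:ℝ), (0:ℝ)) ∈ Set.Icc (0:ℝ) R ×ˢ Set.Icc (0:ℝ) R :=
    Set.mk_mem_prod ⟨le_rfl, hR0.le⟩ ⟨le_rfl, hR0.le⟩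
  obtain ⟨z, hz, hzmax⟩ := ((isCompact_Icc (a := (0:ℝ)) (b := R)).prod (isCompact_Icc (a := (0:ℝ)) (b := R))).exists_isMaxOn
    ⟨_, h0R⟩ hcont.continuousOn
  have hzmax : ∀ w ∈ Set.Icc (0:ℝ) R ×ˢ Set.Icc (0:ℝ) R, Jr r a1 a2 q1 q2 q12 w.1 w.2 ≤ Jr r a1 a2 q1 q2 q12 z.1 z.2 := hzmax
  have h00 : Jr r a1 a2 q1 q2 q12 0 0 = 0 := by
    rw [Jr_zero hr, Real.zero_rpow (by linarith)]; ring
  have hz0 : 0 ≤ Jr r a1 a2 q1 q2 q12 z.1 z.2 := by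
    rw [← h00]; exact hzmax _ h0R
  have hmax : ∀ s t : ℝ, 0 ≤ s → 0 ≤ t → Jr r a1 a2 q1 q2 q12 s t ≤ Jr r a1 a2 q1 q2 q12 z.1 z.2 := by
    intro s t hs ht
    by_cases hneg : Jr r a1 a2 q1 q2 q12 s t < 0
    · linarith
    · have h1 := Jr_le (s := s) (t := t) hr hs ht (le_max_left a1 a2) (le_max_right a1 a2) hq hl k1 k2
      obtain ⟨b1, b2⟩ := hR s t hs ht (by linarith [not_lt.1 hneg])
      exact hzmax (s, t) (Set.mk_mem_prod ⟨hs, b1⟩ ⟨ht, b2⟩)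
  have hz1 : 0 ≤ z.1 := hz.1.1
  have hz2 : 0 ≤ z.2 := hz.2.1
  have hmax' : ∀ s t : ℝ, 0 ≤ s → 0 ≤ t → Jr r a2 a1 q2 q1 q12 s t ≤ Jr r a2 a1 q2 q1 q12 z.2 z.1 := by
    intro s t hs ht
    rw [Jr_swap, Jr_swap r a2 a1]; exact hmax t s ht hs
  have P1 := nr_pos hr ha1 ha2 hq1 hq2 hq n1 n3 hdet hz1 hz2 hmax
  have P2 := nr_pos hr ha2 ha1 hq2 hq1 hq n2 (fun h h' => by rw [mul_comm]; exact n3 h' h)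
    (by rw [mul_comm]; exact hdet) hz2 hz1 hmax'
  refine ⟨z.1, z.2, P1, P2, nr_crit hr P1 hz2 hmax, ?_⟩
  have := nr_crit hr P2 hz1 hmax'
  rw [mul_comm (z.1 ^ r)]; exact this

open Filter Topology in
theorem nr_danskin {r a1 a2 q1 q2 q12 : ℝ} (hr : 1 < r) (ha1 : 0 ≤ a1) (ha2 : 0 ≤ a2)
    (hq1 : 0 < q1) (hq2 : 0 < q2) (hq : 0 ≤ q12) (e1 : a1 + q12 = q1) (e2 : a2 + q12 = q2)
    (hdet : q12 ^ 2 < q1 * q2) {A Q1 Q12 : ℝ → ℝ} {A' Q1' Q12' : ℝ}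
    (hA : HasDerivAt A A' 0) (hQ1 : HasDerivAt Q1 Q1' 0) (hQ12 : HasDerivAt Q12 Q12' 0)
    (hA0 : A 0 = a1) (hQ10 : Q1 0 = q1) (hQ120 : Q12 0 = q12) (hpos : ∀ ε, 0 ≤ Q12 ε)
    (H : ∀ᶠ ε in 𝓝[>] (0:ℝ), ∃ s t : ℝ, 0 ≤ s ∧ 0 ≤ t ∧
      (1 / 2 - 1 / (2 * r)) * (a1 + a2) - ε ^ 2 ≤ Jr r (A ε) a2 (Q1 ε) q2 (Q12 ε) s t) :
    0 ≤ A' / 2 - (Q1' - 2 * Q12') / (2 * r) := by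
  have hr0 : 0 < r := by linarith
  set M := (1 / 2 - 1 / (2 * r)) * (a1 + a2) with hM
  have hch : ∀ ε : ℝ, ∃ z : ℝ × ℝ, (∃ s t : ℝ, 0 ≤ s ∧ 0 ≤ t ∧
      M - ε ^ 2 ≤ Jr r (A ε) a2 (Q1 ε) q2 (Q12 ε) s t) → 0 ≤ z.1 ∧ 0 ≤ z.2 ∧
      M - ε ^ 2 ≤ Jr r (A ε) a2 (Q1 ε) q2 (Q12 ε) z.1 z.2 := by
    intro ε
    by_cases h : ∃ s t : ℝ, 0 ≤ s ∧ 0 ≤ t ∧ M - ε ^ 2 ≤ Jr r (A ε) a2 (Q1 ε) q2 (Q12 ε) s t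
    · obtain ⟨s, t, h1⟩ := h
      exact ⟨(s, t), fun _ => h1⟩
    · exact ⟨(0, 0), fun h' => absurd h' h⟩
  choose z hz using hch
  have hz' := H.mono fun ε h => hz ε h
  have tl : ∀ {f : ℝ → ℝ} {f' : ℝ}, HasDerivAt f f' 0 → Tendsto f (𝓝[>] 0) (𝓝 (f 0)) :=
    fun h => h.continuousAt.tendsto.mono_left nhdsWithin_le_nhds
  have tA := tl hA
  have tQ1 := tl hQ1
  have tQ12 := tl hQ12
  rw [hA0] at tA
  rw [hQ10] at tQ1
  rw [hQ120] at tQ12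
  have tid : Tendsto (fun ε : ℝ => ε) (𝓝[>] 0) (𝓝 0) := tendsto_id.mono_left nhdsWithin_le_nhds
  obtain ⟨l, κ, hl, hκ, k1, k2⟩ := nr_lambda hq1 hq2 hq hdet
  obtain ⟨R, hR0, hR⟩ := nr_coer (a := (max a1 a2 + 1) / 2) (κ := κ / 2 / (2 * r)) hr (by positivity) (M - 1)
  have hbox : ∀ᶠ ε in 𝓝[>] (0:ℝ), z ε ∈ Set.Icc ((0:ℝ), (0:ℝ)) (R, R) := by
    have b1 : ∀ᶠ ε in 𝓝[>] (0:ℝ), A ε < max a1 a2 + 1 :=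
      tA.eventually_lt_const (by linarith [le_max_left a1 a2])
    have b2 : ∀ᶠ ε in 𝓝[>] (0:ℝ), Q12 ε * l - Q1 ε < -(κ / 2) :=
      ((tQ12.mul_const l).sub tQ1).eventually_lt_const (by linarith)
    have b3 : ∀ᶠ ε in 𝓝[>] (0:ℝ), Q12 ε / l < q2 - κ / 2 :=
      (tQ12.div_const l).eventually_lt_const (by linarith)
    have b4 : ∀ᶠ ε in 𝓝[>] (0:ℝ), ε ^ 2 < 1 := by
      have := tid.pow 2
      exact this.eventually_lt_const (by norm_num)
    filter_upwards [hz', b1, b2, b3, b4] with ε h0 h1 h2 h3 h4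
    obtain ⟨p1, p2, p3⟩ := h0
    have := Jr_le (s := (z ε).1) (t := (z ε).2) (κ := κ / 2) (q1 := Q1 ε) (q2 := q2) (q12 := Q12 ε) hr p1 p2 h1.le
      (show a2 ≤ max a1 a2 + 1 by linarith [le_max_right a1 a2]) (hpos ε) hl (by linarith) h3.le
    obtain ⟨c1, c2⟩ := hR _ _ p1 p2 (by linarith)
    exact ⟨⟨p1, p2⟩, ⟨c1, c2⟩⟩
  have hJ : ∀ s t : ℝ, 0 ≤ s → 0 ≤ t → Jr r a1 a2 q1 q2 q12 s t ≤ M := fun s t hs ht =>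
    (Jr_tangent hr hs ht ha1 ha2 hq e1 e2).1
  have hlim : Tendsto z (𝓝[>] 0) (𝓝 ((1:ℝ), (1:ℝ))) := by
    refine (isCompact_Icc (a := ((0:ℝ), (0:ℝ))) (b := (R, R))).tendsto_nhds_of_unique_mapClusterPt hbox ?_
    intro y hy hcl
    obtain ⟨U, hU, hUt⟩ := mapClusterPt_iff_ultrafilter.1 hcl
    have t1 : Tendsto (fun ε => (A ε, a2, Q1 ε, q2, Q12 ε, (z ε).1, (z ε).2)) U
        (𝓝 (a1, a2, q1, q2, q12, y.1, y.2)) := by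
      refine (tA.mono_left hU).prodMk_nhds (tendsto_const_nhds.prodMk_nhds
        ((tQ1.mono_left hU).prodMk_nhds (tendsto_const_nhds.prodMk_nhds ((tQ12.mono_left hU).prodMk_nhds
        (((continuous_fst.tendsto _).comp hUt).prodMk_nhds ((continuous_snd.tendsto _).comp hUt))))))
    have t2 := ((Jr_cont hr).tendsto _).comp t1
    have t3 : Tendsto (fun ε : ℝ => M - ε ^ 2) U (𝓝 M) := by
      have := ((tid.pow 2).const_sub M).mono_left hU
      simpa using this
    have hge : M ≤ Jr r a1 a2 q1 q2 q12 y.1 y.2 :=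
      le_of_tendsto_of_tendsto t3 t2 ((hz'.filter_mono hU).mono fun ε h => h.2.2)
    have := (Jr_tangent hr hy.1.1 hy.1.2 ha1 ha2 hq e1 e2).2 hq1 hdet
      (le_antisymm (hJ _ _ hy.1.1 hy.1.2) hge)
    exact Prod.ext this.1 this.2
  have ts : Tendsto (fun ε => (z ε).1) (𝓝[>] 0) (𝓝 1) := (continuous_fst.tendsto _).comp hlim
  have tt : Tendsto (fun ε => (z ε).2) (𝓝[>] 0) (𝓝 1) := (continuous_snd.tendsto _).comp hlim
  have dA := hA.tendsto_slope_zero_right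
  have dQ1 := hQ1.tendsto_slope_zero_right
  have dQ12 := hQ12.tendsto_slope_zero_right
  simp only [zero_add, smul_eq_mul, hA0, hQ10, hQ120] at dA dQ1 dQ12
  have ts2 := ts.rpow_const (p := 2 * r) (Or.inl one_ne_zero)
  have tsr := ts.rpow_const (p := r) (Or.inl one_ne_zero)
  have ttr := tt.rpow_const (p := r) (Or.inl one_ne_zero)
  have big := (((ts.pow 2).mul dA).div_const 2).sub
    (((ts2.mul dQ1).sub (((tsr.mul ttr).mul dQ12).const_mul 2)).div_const (2 * r))
  simp only [Real.one_rpow, one_mul, one_pow] at big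
  have tneg : Tendsto (fun ε : ℝ => -ε) (𝓝[>] 0) (𝓝 0) := by simpa using tid.neg
  refine le_of_tendsto_of_tendsto tneg big ?_
  filter_upwards [hz', self_mem_nhdsWithin] with ε h hε
  have hε : 0 < ε := hε
  have h2 := hJ _ _ h.1 h.2.1
  have h3 := h.2.2
  have h4 : -ε ^ 2 ≤ Jr r (A ε) a2 (Q1 ε) q2 (Q12 ε) (z ε).1 (z ε).2 - Jr r a1 a2 q1 q2 q12 (z ε).1 (z ε).2 := by
    linarith
  have h5 : ε⁻¹ * -ε ^ 2 ≤ ε⁻¹ * _ := mul_le_mul_of_nonneg_left h4 (by positivity)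
  have h6 : ε⁻¹ * -ε ^ 2 = -ε := by field_simp
  rw [h6] at h5
  refine h5.trans (le_of_eq ?_)
  unfold Jr
  ring

open MeasureTheory in
theorem ci_int {f : UnitAddCircle → ℝ} (hf : Continuous f) : Integrable f :=
  hf.integrable_of_hasCompactSupport (HasCompactSupport.of_compactSpace f)

instance : MeasureTheory.IsProbabilityMeasure (MeasureTheory.volume : MeasureTheory.Measure UnitAddCircle) :=
  ⟨UnitAddCircle.measure_univ⟩

open MeasureTheory in
theorem ci_const (c : ℝ) : ∫ _ : UnitAddCircle, c = c := by simp

open MeasureTheory in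
theorem ci_cont {Y : Type*} [TopologicalSpace Y] {F : Y → UnitAddCircle → ℝ}
    (hF : Continuous (Function.uncurry F)) : Continuous (fun y => ∫ x, F y x) := by
  have h1 : Continuous (fun f : C(UnitAddCircle, ℝ) => ∫ x, f x) := by
    refine LipschitzWith.continuous (K := 1) (LipschitzWith.of_dist_le_mul fun f g => ?_)
    rw [Real.dist_eq, ← integral_sub (ci_int f.continuous) (ci_int g.continuous)]
    have hb : ∀ᵐ x : UnitAddCircle, ‖f x - g x‖ ≤ dist f g :=
      Filter.Eventually.of_forall fun x => by
        have := ContinuousMap.dist_apply_le_dist (f := f) (g := g) x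
        rwa [Real.dist_eq] at this
    have := norm_integral_le_of_norm_le_const hb
    simpa using this
  have h2 : Continuous (fun y => (⟨F y, hF.comp (by fun_prop : Continuous fun x => (y, x))⟩ : C(UnitAddCircle, ℝ))) :=
    ContinuousMap.continuous_of_continuous_uncurry _ hF
  exact h1.comp h2

open MeasureTheory in
theorem ci_deriv {G G' : ℝ → UnitAddCircle → ℝ} (hG : Continuous (Function.uncurry G))
    (hG' : Continuous (Function.uncurry G')) (hd : ∀ e x, HasDerivAt (fun e => G e x) (G' e x) e) :
    HasDerivAt (fun e => ∫ x, G e x) (∫ x, G' 0 x) 0 := by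
  have cs : ∀ {H : ℝ → UnitAddCircle → ℝ}, Continuous (Function.uncurry H) → ∀ e, Continuous (H e) :=
    fun h e => h.comp (by fun_prop : Continuous fun x => (e, x))
  obtain ⟨C, hC⟩ := ((isCompact_Icc (a := (-1:ℝ)) (b := 1)).prod (isCompact_univ (X := UnitAddCircle))).bddAbove_image
    hG'.norm.continuousOn
  refine (hasDerivAt_integral_of_dominated_loc_of_deriv_le (μ := volume) (F := G) (F' := G') (x₀ := (0:ℝ))
    (bound := fun _ => C) (s := Set.Icc (-1) 1) (Icc_mem_nhds (by norm_num) (by norm_num))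
    (Filter.Eventually.of_forall fun e => (cs hG e).aestronglyMeasurable) (ci_int (cs hG 0))
    (cs hG' 0).aestronglyMeasurable
    (Filter.Eventually.of_forall fun x e he => hC ⟨(e, x), ⟨he, trivial⟩, rfl⟩)
    (integrable_const C) (Filter.Eventually.of_forall fun x e _ => hd e x)).2

/-- The step. -/
noncomputable def hst (n : ℕ) : UnitAddCircle := (((1 / 2) ^ n : ℝ) : UnitAddCircle)

open MeasureTheory in
/-- The discrete energy. -/
noncomputable def en (n : ℕ) (u : C(UnitAddCircle, ℝ)) : ℝ := 4 ^ n * ∫ x, (u (x + hst n) - u x) ^ 2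

open MeasureTheory in
theorem en_nonneg (n : ℕ) (u : C(UnitAddCircle, ℝ)) : 0 ≤ en n u :=
  mul_nonneg (by positivity) (integral_nonneg fun x => sq_nonneg _)

theorem hst_succ (n : ℕ) : hst n = hst (n + 1) + hst (n + 1) := by
  unfold hst
  rw [← AddCircle.coe_add]; congr 1; ring

open MeasureTheory in
theorem en_succ (n : ℕ) (u : C(UnitAddCircle, ℝ)) : en n u ≤ en (n + 1) u := by
  set h := hst (n + 1) with hh
  have c1 : Continuous fun x : UnitAddCircle => (u (x + h) - u x) ^ 2 := by fun_prop
  have c2 : Continuous fun x : UnitAddCircle => (u (x + h + h) - u (x + h)) ^ 2 := by fun_prop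
  have c3 : Continuous fun x : UnitAddCircle => (u (x + hst n) - u x) ^ 2 := by fun_prop
  have e1 : ∫ x, (u (x + h + h) - u (x + h)) ^ 2 = ∫ x, (u (x + h) - u x) ^ 2 :=
    integral_add_right_eq_self (fun x => (u (x + h) - u x) ^ 2) h
  have e2 : ∫ x, (u (x + hst n) - u x) ^ 2 ≤ ∫ x, (2 * (u (x + h + h) - u (x + h)) ^ 2 + 2 * (u (x + h) - u x) ^ 2) := by
    refine integral_mono (ci_int c3) (ci_int (by fun_prop)) fun x => ?_
    have : x + hst n = x + h + h := by rw [hst_succ n, add_assoc]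
    simp only [this]
    nlinarith [sq_nonneg ((u (x + h + h) - u (x + h)) - (u (x + h) - u x))]
  rw [integral_add (ci_int (by fun_prop)) (ci_int (by fun_prop)), integral_const_mul, integral_const_mul, e1] at e2
  unfold en
  rw [pow_succ]
  have : (0:ℝ) < 4 ^ n := by positivity
  nlinarith

theorem en_mono (u : C(UnitAddCircle, ℝ)) : Monotone (fun n => en n u) :=
  monotone_nat_of_le_succ fun n => en_succ n u

open MeasureTheory in
theorem en_smul (n : ℕ) (c : ℝ) (u : C(UnitAddCircle, ℝ)) : en n (c • u) = c ^ 2 * en n u := by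
  unfold en
  have : ∫ x, ((c • u) (x + hst n) - (c • u) x) ^ 2 = ∫ x, c ^ 2 * (u (x + hst n) - u x) ^ 2 := by
    congr 1; ext x; simp; ring
  rw [this, integral_const_mul]; ring

open MeasureTheory in
theorem en_abs (n : ℕ) (u : C(UnitAddCircle, ℝ)) : en n |u| ≤ en n u := by
  unfold en
  refine mul_le_mul_of_nonneg_left (integral_mono (ci_int (by fun_prop)) (ci_int (by fun_prop)) fun x => ?_) (by positivity)
  simp only [ContinuousMap.abs_apply]
  exact sq_le_sq.2 (abs_abs_sub_abs_le _ _)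

theorem en_cont (n : ℕ) : Continuous (en n) := by
  unfold en
  refine continuous_const.mul (ci_cont (F := fun (u : C(UnitAddCircle, ℝ)) x => (u (x + hst n) - u x) ^ 2) ?_)
  unfold Function.uncurry
  fun_prop

theorem hst_norm (n : ℕ) : ‖hst n‖ ≤ (1 / 2) ^ n := by
  unfold hst
  refine (QuotientAddGroup.norm_mk_le_norm (S := AddSubgroup.zmultiples (1:ℝ)) (m := ((1/2)^n : ℝ))).trans ?_
  rw [Real.norm_eq_abs, abs_of_nonneg (by positivity)]

open MeasureTheory in
theorem en_lip (n : ℕ) {L : ℝ} {u : C(UnitAddCircle, ℝ)} (h : ∀ x y, |u x - u y| ≤ L * ‖x - y‖) (hL : 0 ≤ L) :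
    en n u ≤ L ^ 2 := by
  unfold en
  have : ∫ x, (u (x + hst n) - u x) ^ 2 ≤ ∫ _ : UnitAddCircle, (L * (1 / 2) ^ n) ^ 2 := by
    refine integral_mono (ci_int (by fun_prop)) (integrable_const _) fun x => ?_
    refine sq_le_sq.2 (((h _ _).trans ?_).trans (le_abs_self _))
    rw [add_sub_cancel_left]
    exact mul_le_mul_of_nonneg_left (hst_norm n) hL
  rw [ci_const] at this
  calc _ ≤ 4 ^ n * (L * (1 / 2) ^ n) ^ 2 := mul_le_mul_of_nonneg_left this (by positivity)
    _ = L ^ 2 := by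
      rw [mul_pow, ← pow_mul, mul_comm n 2, pow_mul]
      rw [show ((1:ℝ) / 2) ^ 2 = 1 / 4 by norm_num, one_div, inv_pow]
      have : (4:ℝ) ^ n ≠ 0 := by positivity
      field_simp

open MeasureTheory in
theorem en_add (n : ℕ) (e : ℝ) (u φ : C(UnitAddCircle, ℝ)) :
    en n (u + e • φ) = en n u + 2 * e * (∫ x, u x * (4 ^ n * (2 * φ x - φ (x + hst n) - φ (x - hst n))))
      + e ^ 2 * en n φ := by
  set h := hst n with hh
  have e1 : ∫ x, u (x + h) * (φ (x + h) - φ x) = ∫ x, u x * (φ x - φ (x - h)) := by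
    rw [← integral_add_right_eq_self (fun x => u x * (φ x - φ (x - h))) h]
    simp only [add_sub_cancel_right]
  have e2 : ∫ x, (u (x + h) - u x) * (φ (x + h) - φ x) = ∫ x, u x * (2 * φ x - φ (x + h) - φ (x - h)) := by
    have a1 : ∫ x, (u (x + h) - u x) * (φ (x + h) - φ x) = ∫ x, (u (x + h) * (φ (x + h) - φ x) - u x * (φ (x + h) - φ x)) := by
      congr 1; ext x; ring
    rw [a1, integral_sub (ci_int (by fun_prop)) (ci_int (by fun_prop)), e1,
      ← integral_sub (ci_int (by fun_prop)) (ci_int (by fun_prop))]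
    congr 1; ext x; ring
  have e3 : ∫ x, u x * (4 ^ n * (2 * φ x - φ (x + h) - φ (x - h))) = 4 ^ n * ∫ x, u x * (2 * φ x - φ (x + h) - φ (x - h)) := by
    rw [← integral_const_mul]; congr 1; ext x; ring
  rw [e3, ← e2]
  unfold en
  have a2 : ∫ x, ((u + e • φ) (x + h) - (u + e • φ) x) ^ 2 = ∫ x, ((u (x + h) - u x) ^ 2 +
      2 * e * ((u (x + h) - u x) * (φ (x + h) - φ x)) + e ^ 2 * (φ (x + h) - φ x) ^ 2) := by
    congr 1; ext x; simp; ring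
  rw [a2, integral_add (ci_int (by fun_prop)) (ci_int (by fun_prop)),
    integral_add (ci_int (by fun_prop)) (ci_int (by fun_prop)), integral_const_mul, integral_const_mul]
  ring

theorem ii_cs {f : ℝ → ℝ} (hf : Continuous f) {a b : ℝ} (hab : a ≤ b) :
    (∫ x in a..b, f x) ^ 2 ≤ (b - a) * ∫ x in a..b, f x ^ 2 := by
  rcases hab.eq_or_lt with rfl | h
  · simp
  set m := (∫ x in a..b, f x) / (b - a) with hm
  have hba : 0 < b - a := by linarith
  have h0 : 0 ≤ ∫ x in a..b, (f x - m) ^ 2 := intervalIntegral.integral_nonneg hab fun x _ => sq_nonneg _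
  have e : ∫ x in a..b, (f x - m) ^ 2 = ∫ x in a..b, (f x ^ 2 - 2 * m * f x + m ^ 2) := by
    congr 1; ext x; ring
  rw [e, intervalIntegral.integral_add (Continuous.intervalIntegrable (by fun_prop) _ _)
    (Continuous.intervalIntegrable (by fun_prop) _ _), intervalIntegral.integral_sub
    (Continuous.intervalIntegrable (by fun_prop) _ _) (Continuous.intervalIntegrable (by fun_prop) _ _),
    intervalIntegral.integral_const_mul, intervalIntegral.integral_const, smul_eq_mul] at h0
  have e2 : ∫ x in a..b, f x = m * (b - a) := by rw [hm]; field_simp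
  rw [e2] at h0 ⊢
  nlinarith

theorem coe_cont : Continuous (fun x : ℝ => (x : UnitAddCircle)) := AddCircle.continuous_mk' 1

theorem en_avg (n : ℕ) (u : C(UnitAddCircle, ℝ)) {x y : ℝ} (hxy : x ≤ y) (hy : y ≤ x + 1) :
    ((2 ^ n) * (∫ t in y..(y + (1 / 2) ^ n), u t) - (2 ^ n) * (∫ t in x..(x + (1 / 2) ^ n), u t)) ^ 2 ≤ (y - x) * en n u := by
  set h : ℝ := (1 / 2) ^ n with hh
  have hc : Continuous fun t : ℝ => u t := u.continuous.comp coe_cont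
  have hi : ∀ a b : ℝ, IntervalIntegrable (fun t : ℝ => u t) MeasureTheory.volume a b :=
    fun a b => hc.intervalIntegrable a b
  have e1 : (∫ t in y..(y + h), u t) - (∫ t in x..(x + h), u t) = ∫ t in x..y, (u ((t + h : ℝ) : UnitAddCircle) - u t) := by
    rw [intervalIntegral.integral_sub (Continuous.intervalIntegrable (by exact hc.comp (by fun_prop)) _ _) (hi _ _),
      intervalIntegral.integral_comp_add_right (fun t : ℝ => u t) h]
    have a1 := intervalIntegral.integral_add_adjacent_intervals (hi x y) (hi y (y + h))
    have a2 := intervalIntegral.integral_add_adjacent_intervals (hi x (x + h)) (hi (x + h) (y + h))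
    linarith
  rw [← mul_sub, mul_pow, e1]
  have hc2 : Continuous fun t : ℝ => u ((t + h : ℝ) : UnitAddCircle) - u t :=
    (hc.comp (by fun_prop : Continuous fun t : ℝ => t + h)).sub hc
  have c1 := ii_cs hc2 hxy
  have c2 : ∫ t in x..y, (u ((t + h : ℝ) : UnitAddCircle) - u t) ^ 2 ≤ ∫ t in x..x+1, (u ((t + h : ℝ) : UnitAddCircle) - u t) ^ 2 := by
    refine intervalIntegral.integral_mono_interval le_rfl hxy hy (Filter.Eventually.of_forall fun t => sq_nonneg _)
      ((hc2.pow 2).intervalIntegrable _ _)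
  have c3 : ∫ t in x..x+1, (u ((t + h : ℝ) : UnitAddCircle) - u t) ^ 2 = ∫ z, (u (z + hst n) - u z) ^ 2 := by
    rw [← UnitAddCircle.intervalIntegral_preimage x]
    simp only [hst, AddCircle.coe_add, hh]
  rw [c3] at c2
  unfold en
  have e4 : ((2:ℝ) ^ n) ^ 2 = 4 ^ n := by rw [← pow_mul, mul_comm, pow_mul]; norm_num
  rw [e4]
  have p4 : (0:ℝ) < 4 ^ n := by positivity
  have := mul_le_mul_of_nonneg_left (c1.trans (mul_le_mul_of_nonneg_left c2 (by linarith))) p4.le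
  linarith

open Filter Topology in
theorem avg_tendsto (u : C(UnitAddCircle, ℝ)) (x : ℝ) :
    Tendsto (fun n : ℕ => (2:ℝ) ^ n * (∫ t in x..(x + (1 / 2) ^ n), u t)) atTop (𝓝 (u x)) := by
  have hc : Continuous fun t : ℝ => u t := u.continuous.comp coe_cont
  have hd := (hc.integral_hasStrictDerivAt x x).hasDerivAt
  have hs := hd.tendsto_slope_zero
  have ht : Tendsto (fun n : ℕ => ((1:ℝ) / 2) ^ n) atTop (𝓝[≠] 0) := by
    refine tendsto_nhdsWithin_iff.2 ⟨tendsto_pow_atTop_nhds_zero_of_lt_one (by norm_num) (by norm_num), ?_⟩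
    exact Eventually.of_forall fun n => by simp
  refine (hs.comp ht).congr fun n => ?_
  simp

theorem en_holder {c : ℝ} {u : C(UnitAddCircle, ℝ)} (h : ∀ n, en n u ≤ c) {x y : ℝ} (hxy : |x - y| ≤ 1) :
    (u x - u y) ^ 2 ≤ c * |x - y| := by
  wlog hle : x ≤ y with H
  · have := H h (by rw [abs_sub_comm]; exact hxy : |y - x| ≤ 1) (not_le.1 hle).le
    rw [abs_sub_comm x y]; nlinarith
  rw [abs_sub_comm, abs_of_nonneg (by linarith)] at hxy ⊢
  have t := (((avg_tendsto u y).sub (avg_tendsto u x)).pow 2)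
  have : (u y - u x) ^ 2 ≤ c * (y - x) := by
    refine le_of_tendsto t (Filter.Eventually.of_forall fun n => ?_)
    refine (en_avg n u hle (by linarith)).trans ?_
    rw [mul_comm]; exact mul_le_mul_of_nonneg_right (h n) (by linarith)
  nlinarith

theorem en_holder' {c : ℝ} {u : C(UnitAddCircle, ℝ)} (h : ∀ n, en n u ≤ c) (x y : UnitAddCircle) :
    (u x - u y) ^ 2 ≤ c * ‖x - y‖ := by
  obtain ⟨a, rfl⟩ := QuotientAddGroup.mk_surjective x
  obtain ⟨b, rfl⟩ := QuotientAddGroup.mk_surjective y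
  have e1 : ((b + round (a - b) : ℝ) : UnitAddCircle) = (b : UnitAddCircle) := by
    rw [AddCircle.coe_add]
    have : ((round (a - b) : ℝ) : UnitAddCircle) = 0 := by
      rw [AddCircle.coe_eq_zero_iff]; exact ⟨round (a - b), by simp⟩
    rw [this, add_zero]
  have e2 : ‖(a : UnitAddCircle) - (b : UnitAddCircle)‖ = |a - (b + round (a - b))| := by
    rw [← AddCircle.coe_sub, UnitAddCircle.norm_eq]; congr 1; ring
  have e3 : |a - (b + round (a - b))| ≤ 1 := by
    have := abs_sub_round (a - b)
    rw [show a - (b + round (a - b)) = a - b - round (a - b) by ring]; linarith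
  have := en_holder h e3
  rw [e1] at this
  change (u (a : UnitAddCircle) - u (b : UnitAddCircle)) ^ 2 ≤ c * ‖(a : UnitAddCircle) - (b : UnitAddCircle)‖
  rw [e2]; exact this

theorem en_compact (c : ℝ) : IsCompact {u : C(UnitAddCircle, ℝ) | ‖u‖ ≤ 1 ∧ ∀ n, en n u ≤ c} := by
  set S := {u : C(UnitAddCircle, ℝ) | ‖u‖ ≤ 1 ∧ ∀ n, en n u ≤ c} with hS
  have hcl : IsClosed S := by
    refine (isClosed_le continuous_norm continuous_const).inter ?_
    have : {u : C(UnitAddCircle, ℝ) | ∀ n, en n u ≤ c} = ⋂ n, {u | en n u ≤ c} := by ext; simp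
    change IsClosed {u : C(UnitAddCircle, ℝ) | ∀ n, en n u ≤ c}
    rw [this]
    exact isClosed_iInter fun n => isClosed_le (en_cont n) continuous_const
  let I := ContinuousMap.isometryEquivBoundedOfCompact UnitAddCircle ℝ
  have hc2 : IsCompact (I.symm ⁻¹' S) := by
    refine BoundedContinuousFunction.arzela_ascoli₂ (Set.Icc (-1) 1) isCompact_Icc _ (hcl.preimage I.symm.continuous) ?_ ?_
    · intro f x hf
      have h1 : ‖I.symm f‖ ≤ 1 := hf.1
      have h2 := (I.symm f).norm_coe_le_norm x
      exact abs_le.1 (h2.trans h1)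
    · refine Metric.equicontinuous_of_continuity_modulus (fun d => Real.sqrt (c * d)) ?_ _ ?_
      · have : Continuous fun d : ℝ => Real.sqrt (c * d) := by fun_prop
        simpa using this.tendsto 0
      · rintro x y ⟨f, hf⟩
        have h1 := en_holder' hf.2 x y
        rw [Real.dist_eq, dist_eq_norm]
        exact Real.abs_le_sqrt h1
  have := hc2.image I.symm.continuous
  rwa [Set.image_preimage_eq _ I.symm.surjective] at this

theorem circ_rep (x y : UnitAddCircle) : ∃ a b : ℝ, (a : UnitAddCircle) = x ∧ (b : UnitAddCircle) = y ∧ ‖x - y‖ = |a - b| := by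
  obtain ⟨a, rfl⟩ := QuotientAddGroup.mk_surjective x
  obtain ⟨b, rfl⟩ := QuotientAddGroup.mk_surjective y
  refine ⟨a, b + round (a - b), rfl, ?_, ?_⟩
  · rw [AddCircle.coe_add]
    have : ((round (a - b) : ℝ) : UnitAddCircle) = 0 := by
      rw [AddCircle.coe_eq_zero_iff]; exact ⟨round (a - b), by simp⟩
    rw [this, add_zero]
  · change ‖(a : UnitAddCircle) - (b : UnitAddCircle)‖ = _
    rw [← AddCircle.coe_sub, UnitAddCircle.norm_eq]; congr 1; ring

/-- `f1` is the derivative of `f`. -/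
def isD (f f1 : C(UnitAddCircle, ℝ)) : Prop :=
  ∀ t : ℝ, HasDerivAt (fun s : ℝ => f (s : UnitAddCircle)) (f1 (t : UnitAddCircle)) t

theorem isD_lip {f f1 : C(UnitAddCircle, ℝ)} (h : isD f f1) (x y : UnitAddCircle) : |f x - f y| ≤ ‖f1‖ * ‖x - y‖ := by
  obtain ⟨a, b, rfl, rfl, e⟩ := circ_rep x y
  rw [e]
  exact Convex.norm_image_sub_le_of_norm_hasDerivWithin_le (f := fun s : ℝ => f (s : UnitAddCircle))
    (fun t _ => (h t).hasDerivWithinAt) (fun t _ => f1.norm_coe_le_norm _) convex_univ trivial trivial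

theorem second_diff {f f1 f2 : C(UnitAddCircle, ℝ)} (h : isD f f1) (h' : isD f1 f2) {ω d : ℝ} (hd : 0 ≤ d)
    (hω : ∀ x y : UnitAddCircle, ‖x - y‖ ≤ d → |f2 x - f2 y| ≤ ω) (t : ℝ) :
    |f ((t + d : ℝ) : UnitAddCircle) + f ((t - d : ℝ) : UnitAddCircle) - 2 * f (t : UnitAddCircle) - d ^ 2 * f2 t| ≤ 2 * ω * d ^ 2 := by
  have p1 : ∀ s : ℝ, HasDerivAt (fun s : ℝ => t + s) 1 s := fun s => (hasDerivAt_id s).const_add t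
  have p2 : ∀ s : ℝ, HasDerivAt (fun s : ℝ => t - s) (-1) s := fun s => (hasDerivAt_id s).const_sub t
  have kd : ∀ s : ℝ, HasDerivAt (fun s : ℝ => f1 ((t + s : ℝ) : UnitAddCircle) - f1 ((t - s : ℝ) : UnitAddCircle) - 2 * s * f2 t)
      (f2 ((t + s : ℝ) : UnitAddCircle) + f2 ((t - s : ℝ) : UnitAddCircle) - 2 * f2 t) s := by
    intro s
    have a1 := (h' (t + s)).comp s (p1 s)
    have a2 := (h' (t - s)).comp s (p2 s)
    have a3 := (((hasDerivAt_id s).const_mul 2).mul_const (f2 (t : UnitAddCircle)))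
    refine ((a1.sub a2).sub a3).congr_deriv ?_
    ring
  have gd : ∀ s : ℝ, HasDerivAt (fun s : ℝ => f ((t + s : ℝ) : UnitAddCircle) + f ((t - s : ℝ) : UnitAddCircle) - 2 * f t - s ^ 2 * f2 t)
      (f1 ((t + s : ℝ) : UnitAddCircle) - f1 ((t - s : ℝ) : UnitAddCircle) - 2 * s * f2 t) s := by
    intro s
    have a1 := (h (t + s)).comp s (p1 s)
    have a2 := (h (t - s)).comp s (p2 s)
    have a3 := ((hasDerivAt_pow 2 s).mul_const (f2 (t : UnitAddCircle)))
    refine (((a1.add a2).sub_const (2 * f t)).sub a3).congr_deriv ?_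
    norm_num
    ring
  have nb : ∀ s ∈ Set.Ico 0 d, ‖f2 ((t + s : ℝ) : UnitAddCircle) + f2 ((t - s : ℝ) : UnitAddCircle) - 2 * f2 t‖ ≤ 2 * ω := by
    intro s hs
    have hn : ‖(s : UnitAddCircle)‖ ≤ d :=
      (QuotientAddGroup.norm_mk_le_norm (S := AddSubgroup.zmultiples (1:ℝ)) (m := s)).trans
        (by rw [Real.norm_eq_abs, abs_of_nonneg hs.1]; exact hs.2.le)
    have b1 := hω ((t + s : ℝ) : UnitAddCircle) t (by rw [AddCircle.coe_add, add_sub_cancel_left]; exact hn)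
    have b2 := hω ((t - s : ℝ) : UnitAddCircle) t (by rw [AddCircle.coe_sub, sub_sub_cancel_left, norm_neg]; exact hn)
    rw [Real.norm_eq_abs]
    rw [abs_le] at *
    constructor <;> linarith [b1.1, b1.2, b2.1, b2.2]
  have kb := norm_image_sub_le_of_norm_deriv_le_segment' (fun s _ => (kd s).hasDerivWithinAt) nb
  have hω0 : 0 ≤ ω := (abs_nonneg _).trans (hω t t (by simpa using hd))
  have gb := norm_image_sub_le_of_norm_deriv_le_segment' (C := 2 * ω * d) (a := 0) (b := d) (fun s _ => (gd s).hasDerivWithinAt) (by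
    intro s hs
    have := kb s ⟨hs.1, hs.2.le⟩
    simp only [add_zero, sub_zero, sub_self, mul_zero, zero_mul] at this
    refine this.trans ?_
    exact mul_le_mul_of_nonneg_left hs.2.le (by linarith)) d ⟨hd, le_rfl⟩
  simp only [Real.norm_eq_abs, add_zero, sub_zero] at gb
  have e : f (t : UnitAddCircle) + f t - 2 * f t - 0 ^ 2 * f2 t = 0 := by ring
  rw [e, sub_zero] at gb
  refine gb.trans (le_of_eq (by ring))

open MeasureTheory Filter Topology in
theorem en_limit {f f1 f2 : C(UnitAddCircle, ℝ)} (h : isD f f1) (h' : isD f1 f2) (u : C(UnitAddCircle, ℝ)) :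
    Tendsto (fun n => ∫ x, u x * (4 ^ n * (2 * f x - f (x + hst n) - f (x - hst n)))) atTop (𝓝 (-∫ x, u x * f2 x)) := by
  have huc : UniformContinuous f2 := CompactSpace.uniformContinuous_of_continuous f2.continuous
  rw [Metric.tendsto_atTop]
  intro ε hε
  set ω := ε / (4 * (‖u‖ + 1)) with hω
  have hu : 0 < ‖u‖ + 1 := by positivity
  have hω0 : 0 < ω := by positivity
  obtain ⟨δ, hδ, hδ2⟩ := Metric.uniformContinuous_iff.1 huc ω hω0
  obtain ⟨n0, hn0⟩ := exists_pow_lt_of_lt_one hδ (by norm_num : (1:ℝ) / 2 < 1)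
  refine ⟨n0, fun n hn => ?_⟩
  have hnd : ((1:ℝ) / 2) ^ n < δ := (pow_le_pow_of_le_one (by norm_num) (by norm_num) hn).trans_lt hn0
  have key : ∀ x : UnitAddCircle, |4 ^ n * (2 * f x - f (x + hst n) - f (x - hst n)) + f2 x| ≤ 2 * ω := by
    intro x
    obtain ⟨t, rfl⟩ := QuotientAddGroup.mk_surjective x
    have := second_diff h h' (ω := ω) (d := (1 / 2) ^ n) (by positivity) (fun x y hxy => (hδ2 (by
      rw [dist_eq_norm]; exact hxy.trans_lt hnd)).le) t
    have e4 : (((1:ℝ) / 2) ^ n) ^ 2 = (4 ^ n)⁻¹ := by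
      rw [← pow_mul, mul_comm, pow_mul, ← inv_pow]; norm_num
    have p4 : (0:ℝ) < 4 ^ n := by positivity
    rw [e4] at this
    change |4 ^ n * (2 * f (t : UnitAddCircle) - f ((t : UnitAddCircle) + hst n) - f ((t : UnitAddCircle) - hst n)) + f2 (t : UnitAddCircle)| ≤ 2 * ω
    have e5 : 4 ^ n * (2 * f (t : UnitAddCircle) - f ((t : UnitAddCircle) + hst n) - f ((t : UnitAddCircle) - hst n)) + f2 (t : UnitAddCircle)
      = - (4 ^ n * (f ((t + (1/2)^n : ℝ) : UnitAddCircle) + f ((t - (1/2)^n : ℝ) : UnitAddCircle) - 2 * f (t : UnitAddCircle) - (4 ^ n)⁻¹ * f2 t)) := by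
      rw [AddCircle.coe_add, AddCircle.coe_sub]
      unfold hst
      field_simp
      ring
    rw [e5, abs_neg, abs_mul, abs_of_pos p4]
    have := mul_le_mul_of_nonneg_left this p4.le
    refine this.trans (le_of_eq ?_)
    field_simp
  have c1 : Continuous fun x : UnitAddCircle => u x * (4 ^ n * (2 * f x - f (x + hst n) - f (x - hst n))) := by fun_prop
  have c2 : Continuous fun x : UnitAddCircle => u x * f2 x := by fun_prop
  rw [Real.dist_eq, sub_neg_eq_add, ← integral_add (ci_int c1) (ci_int c2)]
  have hb : ∀ᵐ x : UnitAddCircle, ‖u x * (4 ^ n * (2 * f x - f (x + hst n) - f (x - hst n))) + u x * f2 x‖ ≤ ‖u‖ * (2 * ω) := by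
    refine Eventually.of_forall fun x => ?_
    rw [← mul_add, norm_mul]
    exact mul_le_mul (u.norm_coe_le_norm x) (key x) (norm_nonneg _) (norm_nonneg _)
  have := norm_integral_le_of_norm_le_const hb
  simp only [probReal_univ, mul_one] at this
  refine lt_of_le_of_lt this ?_
  have : ‖u‖ * (2 * ω) < (‖u‖ + 1) * (4 * ω) := by nlinarith [norm_nonneg u]
  have e : (‖u‖ + 1) * (4 * ω) = ε := by rw [hω]; field_simp
  linarith

open MeasureTheory Filter Topology in
theorem en_pert {f f1 f2 u : C(UnitAddCircle, ℝ)} (h : isD f f1) (h' : isD f1 f2) {a : ℝ} (ha : ∀ n, en n u ≤ a)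
    (e : ℝ) (n : ℕ) : en n (u + e • f) ≤ a + 2 * e * (-∫ x, u x * f2 x) + e ^ 2 * ‖f1‖ ^ 2 := by
  have t := ((en_limit h h' u).const_mul (2 * e)).const_add a |>.add_const (e ^ 2 * ‖f1‖ ^ 2)
  refine ge_of_tendsto t ?_
  filter_upwards [eventually_ge_atTop n] with m hm
  refine (en_mono _ hm).trans ?_
  simp only []
  rw [en_add]
  have := mul_le_mul_of_nonneg_left (en_lip m (isD_lip h) (norm_nonneg _)) (sq_nonneg e)
  linarith [ha m]

theorem ci_lift {f : ℝ → ℝ} (hf : Continuous f) (hp : Function.Periodic f 1) :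
    ∃ F : C(UnitAddCircle, ℝ), ∀ t : ℝ, F (t : UnitAddCircle) = f t := by
  have hc : Continuous (hp.lift : UnitAddCircle → ℝ) := continuous_coinduced_dom.2 hf
  exact ⟨⟨hp.lift, hc⟩, fun t => hp.lift_coe t⟩

open MeasureTheory in
theorem ci_prim {g : C(UnitAddCircle, ℝ)} (hg : ∫ x, g x = 0) :
    ∃ G : C(UnitAddCircle, ℝ), isD G g ∧ ∫ x, G x = 0 := by
  have hc : Continuous fun t : ℝ => g t := g.continuous.comp coe_cont
  have hd : ∀ t : ℝ, HasDerivAt (fun t : ℝ => ∫ s in (0:ℝ)..t, g s) (g t) t := fun t =>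
    (hc.integral_hasStrictDerivAt 0 t).hasDerivAt
  have hp : Function.Periodic (fun t : ℝ => ∫ s in (0:ℝ)..t, g s) 1 := by
    intro t
    have := intervalIntegral.integral_add_adjacent_intervals (hc.intervalIntegrable (μ := volume) 0 t) (hc.intervalIntegrable t (t + 1))
    rw [UnitAddCircle.intervalIntegral_preimage t g, hg] at this
    simp only
    linarith
  obtain ⟨F, hF⟩ := ci_lift (continuous_iff_continuousAt.2 fun t => (hd t).continuousAt) hp
  set K := ContinuousMap.const UnitAddCircle (∫ x, F x) with hK
  refine ⟨F - K, fun t => ?_, ?_⟩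
  · have : (fun s : ℝ => (F - K) (s : UnitAddCircle)) = fun s : ℝ => (∫ r in (0:ℝ)..s, g r) - ∫ x, F x := by
      ext s; simp [hF, hK]
    rw [this]
    exact (hd t).sub_const _
  · have : ∫ x, (F - K) x = ∫ x, (F x - ∫ x, F x) := by simp [hK]
    rw [this, integral_sub (ci_int F.continuous) (integrable_const _), ci_const, sub_self]

theorem isD_mul {f f1 g g1 : C(UnitAddCircle, ℝ)} (h : isD f f1) (h' : isD g g1) : isD (f * g) (f1 * g + f * g1) :=
  fun t => (h t).mul (h' t)

theorem isD_sub {f f1 g g1 : C(UnitAddCircle, ℝ)} (h : isD f f1) (h' : isD g g1) : isD (f - g) (f1 - g1) :=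
  fun t => (h t).sub (h' t)

theorem isD_neg {f f1 : C(UnitAddCircle, ℝ)} (h : isD f f1) : isD (-f) (-f1) :=
  fun t => (h t).neg

theorem isD_const (c : ℝ) : isD (ContinuousMap.const _ c) 0 := fun t => hasDerivAt_const t c

open MeasureTheory in
theorem isD_int {f f1 : C(UnitAddCircle, ℝ)} (h : isD f f1) : ∫ x, f1 x = 0 := by
  rw [← UnitAddCircle.intervalIntegral_preimage 0,
    intervalIntegral.integral_eq_sub_of_hasDerivAt (fun t _ => h t)
      ((f1.continuous.comp coe_cont).intervalIntegrable _ _)]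
  have : ((0 + 1 : ℝ) : UnitAddCircle) = ((0:ℝ) : UnitAddCircle) := by
    simp
  rw [this, sub_self]

open MeasureTheory in
theorem ci_sq_zero {k : C(UnitAddCircle, ℝ)} (h : ∫ x, k x ^ 2 = 0) : k = 0 := by
  have h1 := (integral_eq_zero_iff_of_nonneg (fun x => sq_nonneg (k x)) (ci_int (by fun_prop))).1 h
  have h2 := (Continuous.ae_eq_iff_eq volume (by fun_prop) continuous_const).1 h1
  ext x
  have : k x ^ 2 = 0 := congrFun h2 x
  exact pow_eq_zero_iff two_ne_zero |>.1 this

open MeasureTheory in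
theorem ci_reg {u F : C(UnitAddCircle, ℝ)}
    (H : ∀ f f1 f2 : C(UnitAddCircle, ℝ), isD f f1 → isD f1 f2 → (∫ x, u x * f2 x) + (∫ x, F x * f x) = 0) :
    ∃ u1 : C(UnitAddCircle, ℝ), isD u u1 ∧ isD u1 (-F) := by
  have hF : ∫ x, F x = 0 := by
    have := H (ContinuousMap.const _ 1) 0 0 (isD_const 1) (isD_const 0)
    simpa using this
  obtain ⟨G, hG, hG0⟩ := ci_prim hF
  obtain ⟨W, hW, -⟩ := ci_prim hG0
  have key : ∀ g : C(UnitAddCircle, ℝ), ∫ x, g x = 0 → ∫ x, (u x + W x) * g x = 0 := by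
    intro g hg
    obtain ⟨f1, hf1, hf10⟩ := ci_prim hg
    obtain ⟨f, hf, -⟩ := ci_prim hf10
    have h1 := H f f1 g hf hf1
    have h2 := isD_int (isD_sub (isD_mul hW hf1) (isD_mul hG hf))
    have h3 : ∫ x, (G * f1 + W * g - (F * f + G * f1)) x = (∫ x, W x * g x) - ∫ x, F x * f x := by
      rw [← integral_sub (ci_int (by fun_prop)) (ci_int (by fun_prop))]
      congr 1; ext x; simp; ring
    rw [h3] at h2
    have h4 : ∫ x, (u x + W x) * g x = (∫ x, u x * g x) + ∫ x, W x * g x := by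
      rw [← integral_add (ci_int (by fun_prop)) (ci_int (by fun_prop))]
      congr 1; ext x; ring
    linarith
  set m := ∫ x, (u x + W x) with hm
  set k : C(UnitAddCircle, ℝ) := u + W - ContinuousMap.const _ m with hk
  have hk0 : ∫ x, k x = 0 := by
    have : ∫ x, k x = ∫ x, ((u x + W x) - m) := by simp [hk]
    rw [this, integral_sub (ci_int (by fun_prop)) (integrable_const _), ci_const, ← hm, sub_self]
  have hkk : ∫ x, k x ^ 2 = 0 := by
    have h1 := key k hk0
    have : ∫ x, k x ^ 2 = ∫ x, ((u x + W x) * k x - m * k x) := by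
      congr 1; ext x
      have : k x = u x + W x - m := by simp [hk]
      rw [this]; ring
    rw [this, integral_sub (ci_int (by fun_prop)) (ci_int (by fun_prop)), h1, integral_const_mul, hk0]; simp
  have hz := ci_sq_zero hkk
  have hu : u = ContinuousMap.const _ m - W := by
    ext x
    have := congrArg (fun f : C(UnitAddCircle, ℝ) => f x) hz
    simp [hk] at this ⊢
    linarith
  refine ⟨-G, ?_, isD_neg hG⟩
  rw [hu]
  have := isD_sub (isD_const m) hW
  rwa [zero_sub] at this

open MeasureTheory in
/-- Power integral. -/
noncomputable def iI (r : ℝ) (u : C(UnitAddCircle, ℝ)) : ℝ := ∫ x, |u x| ^ (2 * r)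

open MeasureTheory in
/-- Coupling integral. -/
noncomputable def iJ (r : ℝ) (u v : C(UnitAddCircle, ℝ)) : ℝ := ∫ x, |u x| ^ r * |v x| ^ r

theorem pw_cont {p : ℝ} (hp : 1 < p) {Y : Type*} [TopologicalSpace Y] {f : Y → ℝ} (hf : Continuous f) :
    Continuous (fun y => |f y| ^ p) := by
  have h : Continuous (fun s : ℝ => s ^ p) := Real.continuous_rpow_const (by linarith)
  exact h.comp hf.abs

theorem iI_cont {r : ℝ} (hr : 1 < r) : Continuous (iI r) := by
  unfold iI
  refine ci_cont (F := fun (u : C(UnitAddCircle, ℝ)) x => |u x| ^ (2 * r)) ?_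
  unfold Function.uncurry
  exact pw_cont (by linarith) (by fun_prop)

theorem iJ_cont {r : ℝ} (hr : 1 < r) : Continuous (fun z : C(UnitAddCircle, ℝ) × C(UnitAddCircle, ℝ) => iJ r z.1 z.2) := by
  unfold iJ
  refine ci_cont (F := fun (z : C(UnitAddCircle, ℝ) × C(UnitAddCircle, ℝ)) x => |z.1 x| ^ r * |z.2 x| ^ r) ?_
  unfold Function.uncurry
  exact (pw_cont hr (by fun_prop)).mul (pw_cont hr (by fun_prop))

open MeasureTheory in
theorem iI_smul {r c : ℝ} (hc : 0 ≤ c) (u : C(UnitAddCircle, ℝ)) : iI r (c • u) = c ^ (2 * r) * iI r u := by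
  unfold iI
  rw [← integral_const_mul]
  congr 1; ext x
  simp only [ContinuousMap.smul_apply, smul_eq_mul]
  rw [abs_mul, abs_of_nonneg hc, Real.mul_rpow hc (abs_nonneg _)]

open MeasureTheory in
theorem iJ_smul {r c d : ℝ} (hc : 0 ≤ c) (hd : 0 ≤ d) (u v : C(UnitAddCircle, ℝ)) :
    iJ r (c • u) (d • v) = c ^ r * d ^ r * iJ r u v := by
  unfold iJ
  rw [← integral_const_mul]
  congr 1; ext x
  simp only [ContinuousMap.smul_apply, smul_eq_mul]
  rw [abs_mul, abs_of_nonneg hc, Real.mul_rpow hc (abs_nonneg _), abs_mul, abs_of_nonneg hd, Real.mul_rpow hd (abs_nonneg _)]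
  ring

theorem iI_abs (r : ℝ) (u : C(UnitAddCircle, ℝ)) : iI r |u| = iI r u := by simp [iI]

theorem iJ_abs (r : ℝ) (u v : C(UnitAddCircle, ℝ)) : iJ r |u| |v| = iJ r u v := by simp [iJ]

theorem iJ_comm (r : ℝ) (u v : C(UnitAddCircle, ℝ)) : iJ r u v = iJ r v u := by simp [iJ, mul_comm]

theorem iJ_nonneg (r : ℝ) (u v : C(UnitAddCircle, ℝ)) : 0 ≤ iJ r u v :=
  MeasureTheory.integral_nonneg fun x => by positivity

theorem iI_nonneg (r : ℝ) (u : C(UnitAddCircle, ℝ)) : 0 ≤ iI r u :=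
  MeasureTheory.integral_nonneg fun x => by positivity

theorem iI_pos {r : ℝ} (hr : 1 < r) {u : C(UnitAddCircle, ℝ)} (hu : u ≠ 0) : 0 < iI r u := by
  refine lt_of_le_of_ne (iI_nonneg r u) fun h => hu ?_
  have hc : Continuous fun x => |u x| ^ (2 * r) := pw_cont (by linarith) u.continuous
  have h1 := (MeasureTheory.integral_eq_zero_iff_of_nonneg (fun x => by positivity) (ci_int hc)).1 h.symm
  have h2 := (Continuous.ae_eq_iff_eq MeasureTheory.volume hc continuous_const).1 h1
  ext x
  have h3 : |u x| ^ (2 * r) = 0 := congrFun h2 x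
  have := (Real.rpow_eq_zero (abs_nonneg _) (by linarith)).1 h3
  simpa using this

theorem iI_le {r : ℝ} (hr : 1 < r) {u : C(UnitAddCircle, ℝ)} (hu : ‖u‖ ≤ 1) : iI r u ≤ 1 := by
  unfold iI
  refine le_trans ?_ (ci_const 1).le
  refine MeasureTheory.integral_mono (ci_int (pw_cont (by linarith) u.continuous)) (MeasureTheory.integrable_const _) fun x => ?_
  exact Real.rpow_le_one (abs_nonneg _) ((u.norm_coe_le_norm x).trans hu) (by linarith)

theorem pw_deriv {p : ℝ} (hp : 1 < p) : Continuous (fun x : ℝ => p * |x| ^ (p - 2) * x) := by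
  have h1 : ContDiff ℝ 1 (fun x : ℝ => ‖x‖ ^ p) := contDiff_norm_rpow hp
  have h2 := h1.continuous_deriv le_rfl
  have h3 : deriv (fun x : ℝ => ‖x‖ ^ p) = fun x : ℝ => p * |x| ^ (p - 2) * x := by
    ext x; exact (hasDerivAt_abs_rpow x hp).deriv
  rwa [h3] at h2

theorem pw_val {p x : ℝ} (hp : 1 < p) (hx : 0 ≤ x) : p * |x| ^ (p - 2) * x = p * x ^ (p - 1) := by
  rcases hx.eq_or_lt with rfl | h
  · rw [Real.zero_rpow (by linarith)]; ring
  · rw [abs_of_pos h, mul_assoc, ← Real.rpow_add_one h.ne']; congr 2; ring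

open MeasureTheory in
theorem iI_deriv {r : ℝ} (hr : 1 < r) {u f : C(UnitAddCircle, ℝ)} (hu : ∀ x, 0 ≤ u x) :
    HasDerivAt (fun e : ℝ => iI r (u + e • f)) (∫ x, 2 * r * u x ^ (2 * r - 1) * f x) 0 := by
  have hp : 1 < 2 * r := by linarith
  have := ci_deriv (G := fun e x => |u x + e * f x| ^ (2 * r))
    (G' := fun e x => (2 * r) * |u x + e * f x| ^ (2 * r - 2) * (u x + e * f x) * f x)
    (by unfold Function.uncurry; exact pw_cont hp (by fun_prop))
    (by
      unfold Function.uncurry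
      exact ((pw_deriv hp).comp (by fun_prop : Continuous fun a : ℝ × UnitAddCircle => u a.2 + a.1 * f a.2)).mul (by fun_prop))
    (fun e x => by
      have h1 : HasDerivAt (fun e : ℝ => u x + e * f x) (f x) e := by
        simpa using ((hasDerivAt_id e).mul_const (f x)).const_add (u x)
      exact (hasDerivAt_abs_rpow _ hp).comp e h1)
  refine this.congr_deriv ?_
  congr 1; ext x
  simp only [zero_mul, add_zero]
  rw [pw_val hp (hu x)]

open MeasureTheory in
theorem iJ_deriv {r : ℝ} (hr : 1 < r) {u v f : C(UnitAddCircle, ℝ)} (hu : ∀ x, 0 ≤ u x) (hv : ∀ x, 0 ≤ v x) :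
    HasDerivAt (fun e : ℝ => iJ r (u + e • f) v) (∫ x, r * u x ^ (r - 1) * f x * v x ^ r) 0 := by
  have := ci_deriv (G := fun e x => |u x + e * f x| ^ r * |v x| ^ r)
    (G' := fun e x => r * |u x + e * f x| ^ (r - 2) * (u x + e * f x) * f x * |v x| ^ r)
    (by unfold Function.uncurry; exact (pw_cont hr (by fun_prop)).mul (pw_cont hr (by fun_prop)))
    (by
      unfold Function.uncurry
      exact (((pw_deriv hr).comp (by fun_prop : Continuous fun a : ℝ × UnitAddCircle => u a.2 + a.1 * f a.2)).mul (by fun_prop)).mul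
        (pw_cont hr (by fun_prop)))
    (fun e x => by
      have h1 : HasDerivAt (fun e : ℝ => u x + e * f x) (f x) e := by
        simpa using ((hasDerivAt_id e).mul_const (f x)).const_add (u x)
      exact ((hasDerivAt_abs_rpow _ hr).comp e h1).mul_const _)
  refine this.congr_deriv ?_
  congr 1; ext x
  simp only [zero_mul, add_zero]
  rw [pw_val hr (hu x), abs_of_nonneg (hv x)]

theorem Jr_mono {r a1 a2 q1 q2 q12 s t A1 A2 : ℝ} (h1 : a1 ≤ A1) (h2 : a2 ≤ A2) :
    Jr r a1 a2 q1 q2 q12 s t ≤ Jr r A1 A2 q1 q2 q12 s t := by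
  unfold Jr
  have := mul_le_mul_of_nonneg_left h1 (sq_nonneg s)
  have := mul_le_mul_of_nonneg_left h2 (sq_nonneg t)
  linarith

theorem Jr_scale {r a1 a2 q1 q2 q12 s t c d : ℝ} (hc : 0 ≤ c) (hd : 0 ≤ d) (hs : 0 ≤ s) (ht : 0 ≤ t) :
    Jr r (c ^ 2 * a1) (d ^ 2 * a2) (c ^ (2 * r) * q1) (d ^ (2 * r) * q2) (c ^ r * d ^ r * q12) s t =
      Jr r a1 a2 q1 q2 q12 (c * s) (d * t) := by
  unfold Jr
  rw [Real.mul_rpow hc hs, Real.mul_rpow hd ht, Real.mul_rpow hc hs, Real.mul_rpow hd ht]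
  ring

/-- Sublevel set. -/
def sS (r b1 b2 b c : ℝ) : Set (C(UnitAddCircle, ℝ) × C(UnitAddCircle, ℝ)) :=
  {z | ((∀ x, 0 ≤ z.1 x) ∧ (∀ x, 0 ≤ z.2 x)) ∧ (‖z.1‖ = 1 ∧ ‖z.2‖ = 1) ∧ ∀ n : ℕ, ∀ s t : ℝ, 0 ≤ s → 0 ≤ t →
    Jr r (en n z.1) (en n z.2) (b1 * iI r z.1) (b2 * iI r z.2) (b * iJ r z.1 z.2) s t ≤ c}

theorem sS_mono {r b1 b2 b c c' : ℝ} (h : c ≤ c') : sS r b1 b2 b c ⊆ sS r b1 b2 b c' :=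
  fun _ hz => ⟨hz.1, hz.2.1, fun n s t hs ht => (hz.2.2 n s t hs ht).trans h⟩

theorem sS_closed {r : ℝ} (hr : 1 < r) (b1 b2 b c : ℝ) : IsClosed (sS r b1 b2 b c) := by
  have e : sS r b1 b2 b c = ((⋂ x, {z | 0 ≤ z.1 x}) ∩ (⋂ x, {z | 0 ≤ z.2 x})) ∩ (({z | ‖z.1‖ = 1} ∩ {z | ‖z.2‖ = 1}) ∩
    ⋂ n : ℕ, ⋂ s : ℝ, ⋂ t : ℝ, ⋂ _ : 0 ≤ s, ⋂ _ : 0 ≤ t,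
      {z | Jr r (en n z.1) (en n z.2) (b1 * iI r z.1) (b2 * iI r z.2) (b * iJ r z.1 z.2) s t ≤ c}) := by
    ext z
    simp only [sS, Set.mem_inter_iff, Set.mem_iInter, Set.mem_ofPred_eq]
  rw [e]
  refine ((isClosed_iInter fun x => isClosed_le continuous_const (by fun_prop)).inter
    (isClosed_iInter fun x => isClosed_le continuous_const (by fun_prop))).inter
    (((isClosed_eq (by fun_prop) continuous_const).inter (isClosed_eq (by fun_prop) continuous_const)).inter
    (isClosed_iInter fun n => isClosed_iInter fun s => isClosed_iInter fun t => isClosed_iInter fun _ => isClosed_iInter fun _ =>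
      isClosed_le ?_ continuous_const))
  have h1 := (en_cont n).comp (continuous_fst (X := C(UnitAddCircle, ℝ)) (Y := C(UnitAddCircle, ℝ)))
  have h2 := (en_cont n).comp (continuous_snd (X := C(UnitAddCircle, ℝ)) (Y := C(UnitAddCircle, ℝ)))
  have h3 := (iI_cont hr).comp (continuous_fst (X := C(UnitAddCircle, ℝ)) (Y := C(UnitAddCircle, ℝ)))
  have h4 := (iI_cont hr).comp (continuous_snd (X := C(UnitAddCircle, ℝ)) (Y := C(UnitAddCircle, ℝ)))
  have h5 := iJ_cont hr
  have h6 := (Jr_cont hr).comp (h1.prodMk (h2.prodMk ((h3.const_mul b1).prodMk ((h4.const_mul b2).prodMk ((h5.const_mul b).prodMk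
    ((continuous_const (y := s)).prodMk (continuous_const (y := t))))))))
  exact h6

theorem Jr_one_zero {r : ℝ} (hr : 1 < r) (a1 a2 q1 q2 q12 : ℝ) :
    Jr r a1 a2 q1 q2 q12 1 0 = a1 / 2 - q1 / (2 * r) := by
  rw [Jr_swap, Jr_zero hr]; simp

theorem sS_compact {r b1 b2 : ℝ} (hr : 1 < r) (hb1 : 0 ≤ b1) (hb2 : 0 ≤ b2) (b c : ℝ) : IsCompact (sS r b1 b2 b c) := by
  refine ((en_compact (2 * c + b1 / r)).prod (en_compact (2 * c + b2 / r))).of_isClosed_subset (sS_closed hr b1 b2 b c) ?_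
  rintro ⟨u, v⟩ ⟨-, ⟨hu, hv⟩, h⟩
  have hr0 : 0 < r := by linarith
  simp only at hu hv h
  have e : ∀ β q : ℝ, 0 ≤ β → q ≤ 1 → β * q / (2 * r) ≤ β / r / 2 := by
    intro β q hβ hq
    rw [div_div, mul_comm r 2]
    exact div_le_div_of_nonneg_right (by nlinarith) (by positivity)
  refine ⟨⟨hu.le, fun n => ?_⟩, ⟨hv.le, fun n => ?_⟩⟩
  · have := h n 1 0 zero_le_one le_rfl
    rw [Jr_one_zero hr] at this
    linarith [e b1 _ hb1 (iI_le hr hu.le)]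
  · have := h n 0 1 le_rfl zero_le_one
    rw [Jr_swap, Jr_one_zero hr] at this
    linarith [e b2 _ hb2 (iI_le hr hv.le)]

theorem sS_norm {r b1 b2 b c A1 A2 : ℝ} {u v : C(UnitAddCircle, ℝ)} (hu : u ≠ 0) (hv : v ≠ 0)
    (h1 : ∀ n, en n u ≤ A1) (h2 : ∀ n, en n v ≤ A2)
    (h : ∀ s t : ℝ, 0 ≤ s → 0 ≤ t → Jr r A1 A2 (b1 * iI r u) (b2 * iI r v) (b * iJ r u v) s t ≤ c) :
    (sS r b1 b2 b c).Nonempty := by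
  have nu : 0 < ‖u‖ := norm_pos_iff.2 hu
  have nv : 0 < ‖v‖ := norm_pos_iff.2 hv
  have nabs : ∀ w : C(UnitAddCircle, ℝ), ‖|w|‖ = ‖w‖ := by
    intro w
    refine le_antisymm ((ContinuousMap.norm_le _ (norm_nonneg _)).2 fun x => ?_) ((ContinuousMap.norm_le _ (norm_nonneg _)).2 fun x => ?_)
    · have := w.norm_coe_le_norm x
      rw [ContinuousMap.abs_apply, Real.norm_eq_abs, abs_abs]; exact this
    · have := (|w|).norm_coe_le_norm x
      rw [ContinuousMap.abs_apply, Real.norm_eq_abs, abs_abs] at this; exact this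
  have pos : ∀ (w : C(UnitAddCircle, ℝ)) (x : UnitAddCircle), 0 ≤ (‖w‖⁻¹ • |w|) x := by
    intro w x
    simp only [ContinuousMap.smul_apply, ContinuousMap.abs_apply, smul_eq_mul]
    positivity
  have n1 : ∀ w : C(UnitAddCircle, ℝ), 0 < ‖w‖ → ‖(‖w‖⁻¹ • |w|)‖ = 1 := by
    intro w hw
    rw [norm_smul, norm_inv, norm_norm, nabs, inv_mul_cancel₀ hw.ne']
  refine ⟨(‖u‖⁻¹ • |u|, ‖v‖⁻¹ • |v|), ⟨pos u, pos v⟩, ⟨n1 u nu, n1 v nv⟩, fun n s t hs ht => ?_⟩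
  have iu : 0 ≤ ‖u‖⁻¹ := by positivity
  have iv : 0 ≤ ‖v‖⁻¹ := by positivity
  simp only
  rw [en_smul, en_smul, iI_smul iu, iI_smul iv, iJ_smul iu iv, iI_abs, iI_abs, iJ_abs, mul_left_comm b1, mul_left_comm b2,
    mul_left_comm b, Jr_scale iu iv hs ht]
  refine (Jr_mono ((en_abs n u).trans (h1 n)) ((en_abs n v).trans (h2 n))).trans (h _ _ (by positivity) (by positivity))

theorem sS_ne {r b1 b2 : ℝ} (hr : 1 < r) (hb1 : 0 < b1) (hb2 : 0 < b2) (b : ℝ) : ∃ c, (sS r b1 b2 b c).Nonempty := by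
  let u : C(UnitAddCircle, ℝ) := ⟨fun x => max 0 (‖x‖ - 1 / 4), by fun_prop⟩
  let v : C(UnitAddCircle, ℝ) := ⟨fun x => max 0 (1 / 4 - ‖x‖), by fun_prop⟩
  have hr0 : 0 < r := by linarith
  have hu : u ≠ 0 := by
    intro h
    have h1 : u ((1 / 2 : ℝ) : UnitAddCircle) = 0 := by rw [h]; rfl
    have h2 : ‖((1 / 2 : ℝ) : UnitAddCircle)‖ = 1 / 2 := by
      have := AddCircle.norm_half_period_eq (1:ℝ)
      simpa using this
    have h3 : max 0 (‖((1 / 2 : ℝ) : UnitAddCircle)‖ - 1 / 4) = 0 := h1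
    rw [h2] at h3
    norm_num at h3
  have hv : v ≠ 0 := by
    intro h
    have h1 : v 0 = 0 := by rw [h]; rfl
    have h3 : max 0 (1 / 4 - ‖(0 : UnitAddCircle)‖) = 0 := h1
    rw [norm_zero] at h3
    norm_num at h3
  have lu : ∀ n, en n u ≤ 1 ^ 2 := fun n => en_lip n (fun x y => by
    have h1 := abs_max_sub_max_le_max (0:ℝ) (‖x‖ - 1 / 4) 0 (‖y‖ - 1 / 4)
    have h2 := abs_norm_sub_norm_le x y
    rw [sub_self, abs_zero, max_eq_right (abs_nonneg (‖x‖ - 1 / 4 - (‖y‖ - 1 / 4))), sub_sub_sub_cancel_right] at h1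
    rw [one_mul]; exact h1.trans h2) zero_le_one
  have lv : ∀ n, en n v ≤ 1 ^ 2 := fun n => en_lip n (fun x y => by
    have h1 := abs_max_sub_max_le_max (0:ℝ) (1 / 4 - ‖x‖) 0 (1 / 4 - ‖y‖)
    have h2 := abs_norm_sub_norm_le x y
    rw [sub_self, abs_zero, max_eq_right (abs_nonneg (1 / 4 - ‖x‖ - (1 / 4 - ‖y‖))), sub_sub_sub_cancel_left, abs_sub_comm ‖y‖ ‖x‖] at h1
    rw [one_mul]; exact h1.trans h2) zero_le_one
  have hJ : iJ r u v = 0 := by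
    unfold iJ
    have : ∀ x, |u x| ^ r * |v x| ^ r = 0 := by
      intro x
      rcases le_total ‖x‖ (1 / 4) with h | h
      · have : u x = 0 := max_eq_left (by linarith : ‖x‖ - 1 / 4 ≤ 0)
        rw [this, abs_zero, Real.zero_rpow hr0.ne', zero_mul]
      · have : v x = 0 := max_eq_left (by linarith : 1 / 4 - ‖x‖ ≤ 0)
        rw [this, abs_zero, Real.zero_rpow hr0.ne', mul_zero]
    simp [this]
  have pu := iI_pos hr hu
  have pv := iI_pos hr hv
  obtain ⟨c1, -, h1⟩ := nr_bdd (a := 1 / 2) (κ := b1 * iI r u / (2 * r)) hr (by positivity)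
  obtain ⟨c2, -, h2⟩ := nr_bdd (a := 1 / 2) (κ := b2 * iI r v / (2 * r)) hr (by positivity)
  refine ⟨c1 + c2, sS_norm hu hv lu lv fun s t hs ht => ?_⟩
  rw [hJ]
  unfold Jr
  have g1 := h1 s hs
  have g2 := h2 t ht
  have : (b1 * iI r u * s ^ (2 * r) + b2 * iI r v * t ^ (2 * r) - 2 * (b * 0) * (s ^ r * t ^ r)) / (2 * r) =
    b1 * iI r u / (2 * r) * s ^ (2 * r) + b2 * iI r v / (2 * r) * t ^ (2 * r) := by ring
  rw [this]
  linarith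

theorem sS_min {r b1 b2 : ℝ} (hr : 1 < r) (hb1 : 0 < b1) (hb2 : 0 < b2) (b : ℝ) :
    ∃ m : ℝ, (sS r b1 b2 b m).Nonempty ∧ ∀ c, (sS r b1 b2 b c).Nonempty → m ≤ c := by
  set C := {c : ℝ | (sS r b1 b2 b c).Nonempty} with hC
  have hne : C.Nonempty := sS_ne hr hb1 hb2 b
  have hbd : BddBelow C := by
    refine ⟨0, ?_⟩
    rintro c ⟨z, hz⟩
    have := hz.2.2 0 0 0 le_rfl le_rfl
    rw [Jr_zero hr, Real.zero_rpow (by linarith)] at this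
    simpa using this
  refine ⟨sInf C, ?_, fun c hc => csInf_le hbd hc⟩
  have key := IsCompact.nonempty_iInter_of_sequence_nonempty_isCompact_isClosed
    (fun k : ℕ => sS r b1 b2 b (sInf C + 1 / ((k : ℝ) + 1)))
    (fun k => sS_mono (by
      have := one_div_le_one_div_of_le (by positivity : (0:ℝ) < (k:ℝ) + 1) (by linarith : (k:ℝ) + 1 ≤ (k:ℝ) + 1 + 1)
      push_cast; linarith))
    (fun k => by
      obtain ⟨c, hc, hc2⟩ := exists_lt_of_csInf_lt hne (by
        have : (0:ℝ) < 1 / ((k : ℝ) + 1) := by positivity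
        linarith : sInf C < sInf C + 1 / ((k : ℝ) + 1))
      exact hc.mono (sS_mono hc2.le))
    (sS_compact hr hb1.le hb2.le b _) (fun k => sS_closed hr b1 b2 b _)
  obtain ⟨z, hz⟩ := key
  rw [Set.mem_iInter] at hz
  refine ⟨z, (hz 0).1, (hz 0).2.1, fun n s t hs ht => ?_⟩
  have t1 : Filter.Tendsto (fun k : ℕ => sInf C + 1 / ((k : ℝ) + 1)) Filter.atTop (nhds (sInf C + 0)) :=
    tendsto_const_nhds.add tendsto_one_div_add_atTop_nhds_zero_nat
  rw [add_zero] at t1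
  exact ge_of_tendsto t1 (Filter.Eventually.of_forall fun k => (hz k).2.2 n s t hs ht)

theorem sS_swap {r b1 b2 b c : ℝ} (h : (sS r b1 b2 b c).Nonempty) : (sS r b2 b1 b c).Nonempty := by
  obtain ⟨z, h1, h2, h3⟩ := h
  refine ⟨z.swap, h1.symm, h2.symm, fun n s t hs ht => ?_⟩
  have := h3 n t s ht hs
  rw [Jr_swap, iJ_comm] at this
  exact this

open Filter Topology MeasureTheory in
theorem el_ineq {r b1 b2 b a1 a2 : ℝ} (hr : 1 < r) (hb1 : 0 < b1) (hb2 : 0 < b2) (hb : 0 ≤ b)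
    {u v : C(UnitAddCircle, ℝ)} (hu : ∀ x, 0 ≤ u x) (hv : ∀ x, 0 ≤ v x) (u0 : u ≠ 0) (v0 : v ≠ 0)
    (ha1 : ∀ n, en n u ≤ a1) (ha2 : ∀ n, en n v ≤ a2)
    (e1 : a1 + b * iJ r u v = b1 * iI r u) (e2 : a2 + b * iJ r u v = b2 * iI r v)
    (hdet : (b * iJ r u v) ^ 2 < (b1 * iI r u) * (b2 * iI r v))
    (hmin : ∀ c, (sS r b1 b2 b c).Nonempty → (1 / 2 - 1 / (2 * r)) * (a1 + a2) ≤ c)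
    {F : C(UnitAddCircle, ℝ)} (hF : ∀ x, F x = b1 * u x ^ (2 * r - 1) - b * (u x ^ (r - 1) * v x ^ r))
    {f f1 f2 : C(UnitAddCircle, ℝ)} (h : isD f f1) (h' : isD f1 f2) :
    (∫ x, u x * f2 x) + (∫ x, F x * f x) ≤ 0 := by
  have hr0 : 0 < r := by linarith
  set D := -∫ x, u x * f2 x with hD
  have dA : HasDerivAt (fun e : ℝ => a1 + 2 * e * D + e ^ 2 * ‖f1‖ ^ 2) (2 * D) 0 := by
    have := (((hasDerivAt_id (0:ℝ)).const_mul 2).mul_const D).const_add a1 |>.add (((hasDerivAt_id (0:ℝ)).pow 2).mul_const (‖f1‖ ^ 2))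
    refine this.congr_deriv ?_
    simp
  have key := nr_danskin hr ((en_nonneg 0 u).trans (ha1 0)) ((en_nonneg 0 v).trans (ha2 0))
    (mul_pos hb1 (iI_pos hr u0)) (mul_pos hb2 (iI_pos hr v0)) (mul_nonneg hb (iJ_nonneg r u v)) e1 e2 hdet dA
    ((iI_deriv hr (f := f) hu).const_mul b1) ((iJ_deriv hr (f := f) hu hv).const_mul b)
    (by simp) (by simp) (by simp) (fun ε => mul_nonneg hb (iJ_nonneg r _ v)) (by
      have c1 : Continuous (fun e : ℝ => u + e • f) := by fun_prop
      have c2 : ∀ᶠ e : ℝ in 𝓝 0, u + e • f ≠ 0 := c1.continuousAt.eventually_ne (by simpa using u0)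
      filter_upwards [c2.filter_mono nhdsWithin_le_nhds, self_mem_nhdsWithin] with e he he0
      by_contra hcon
      push Not at hcon
      have := hmin _ (sS_norm he v0 (fun n => en_pert h h' ha1 e n) ha2 (fun s t hs ht => (hcon s t hs ht).le))
      have : 0 < e ^ 2 := pow_pos he0 2
      linarith)
  have cu1 : Continuous fun x => u x ^ (2 * r - 1) :=
    (Real.continuous_rpow_const (by linarith : 0 ≤ 2 * r - 1)).comp u.continuous
  have cu2 : Continuous fun x => u x ^ (r - 1) :=
    (Real.continuous_rpow_const (by linarith : 0 ≤ r - 1)).comp u.continuous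
  have cv : Continuous fun x => v x ^ r :=
    (Real.continuous_rpow_const hr0.le).comp v.continuous
  have g1 : ∫ x, 2 * r * u x ^ (2 * r - 1) * f x = 2 * r * ∫ x, u x ^ (2 * r - 1) * f x := by
    rw [← integral_const_mul]; congr 1; ext x; ring
  have g2 : ∫ x, r * u x ^ (r - 1) * f x * v x ^ r = r * ∫ x, u x ^ (r - 1) * v x ^ r * f x := by
    rw [← integral_const_mul]; congr 1; ext x; ring
  have g3 : ∫ x, F x * f x = b1 * (∫ x, u x ^ (2 * r - 1) * f x) - b * ∫ x, u x ^ (r - 1) * v x ^ r * f x := by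
    rw [← integral_const_mul, ← integral_const_mul, ← integral_sub (ci_int (by fun_prop)) (ci_int (by fun_prop))]
    congr 1; ext x; rw [hF]; ring
  rw [g1, g2] at key
  rw [g3]
  set P := ∫ x, u x ^ (2 * r - 1) * f x
  set Q := ∫ x, u x ^ (r - 1) * v x ^ r * f x
  have : (b1 * (2 * r * P) - 2 * (b * (r * Q))) / (2 * r) = b1 * P - b * Q := by field_simp
  rw [this] at key
  linarith

open Filter Topology MeasureTheory in
theorem el_eq {r b1 b2 b a1 a2 : ℝ} (hr : 1 < r) (hb1 : 0 < b1) (hb2 : 0 < b2) (hb : 0 ≤ b)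
    {u v : C(UnitAddCircle, ℝ)} (hu : ∀ x, 0 ≤ u x) (hv : ∀ x, 0 ≤ v x) (u0 : u ≠ 0) (v0 : v ≠ 0)
    (ha1 : ∀ n, en n u ≤ a1) (ha2 : ∀ n, en n v ≤ a2)
    (e1 : a1 + b * iJ r u v = b1 * iI r u) (e2 : a2 + b * iJ r u v = b2 * iI r v)
    (hdet : (b * iJ r u v) ^ 2 < (b1 * iI r u) * (b2 * iI r v))
    (hmin : ∀ c, (sS r b1 b2 b c).Nonempty → (1 / 2 - 1 / (2 * r)) * (a1 + a2) ≤ c) :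
    ∃ u1 F : C(UnitAddCircle, ℝ), isD u u1 ∧ isD u1 (-F) ∧ 
      ∀ x, F x = b1 * u x ^ (2 * r - 1) - b * (u x ^ (r - 1) * v x ^ r) := by
  have cu1 : Continuous fun x => u x ^ (2 * r - 1) :=
    (Real.continuous_rpow_const (by linarith : 0 ≤ 2 * r - 1)).comp u.continuous
  have cu2 : Continuous fun x => u x ^ (r - 1) :=
    (Real.continuous_rpow_const (by linarith : 0 ≤ r - 1)).comp u.continuous
  have cv : Continuous fun x => v x ^ r :=
    (Real.continuous_rpow_const (by linarith)).comp v.continuous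
  let F : C(UnitAddCircle, ℝ) := ⟨fun x => b1 * u x ^ (2 * r - 1) - b * (u x ^ (r - 1) * v x ^ r), by fun_prop⟩
  have hF : ∀ x, F x = b1 * u x ^ (2 * r - 1) - b * (u x ^ (r - 1) * v x ^ r) := fun x => rfl
  obtain ⟨u1, h1, h2⟩ := ci_reg (u := u) (F := F) (fun f f1 f2 h h' => by
    have i1 := el_ineq hr hb1 hb2 hb hu hv u0 v0 ha1 ha2 e1 e2 hdet hmin hF h h'
    have i2 := el_ineq hr hb1 hb2 hb hu hv u0 v0 ha1 ha2 e1 e2 hdet hmin hF (isD_neg h) (isD_neg h')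
    simp only [ContinuousMap.neg_apply, mul_neg, integral_neg] at i2
    linarith)
  exact ⟨u1, F, h1, h2, hF⟩

open Filter Topology in
theorem en_const {u : C(UnitAddCircle, ℝ)} (hu : ∀ x, 0 ≤ u x) (hn : ‖u‖ = 1) (h : ∀ n, en n u ≤ 0) (x : UnitAddCircle) :
    u x = 1 := by
  have e : ∀ y, u y = u x := fun y => by
    have := en_holder' h y x
    rw [zero_mul] at this
    have := pow_eq_zero_iff (two_ne_zero) |>.1 (le_antisymm this (sq_nonneg _))
    linarith
  have : ‖u‖ = |u x| := by
    refine le_antisymm ((ContinuousMap.norm_le _ (abs_nonneg _)).2 fun y => ?_) (u.norm_coe_le_norm x)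
    rw [e y]; exact le_rfl
  rw [hn, abs_of_nonneg (hu x)] at this
  exact this.symm

open Filter Topology in
theorem el_main {r b1 b2 b : ℝ} (hr : 1 < r) (hb1 : 0 < b1) (hb2 : 0 < b2) (hb : 0 < b) (hbb : b1 * b2 < b ^ 2) :
    ∃ u v u1 v1 F G : C(UnitAddCircle, ℝ), (∀ x, 0 ≤ u x) ∧ (∀ x, 0 ≤ v x) ∧ u ≠ 0 ∧
      isD u u1 ∧ isD u1 (-F) ∧ isD v v1 ∧ isD v1 (-G) ∧
      (∀ x, F x = b1 * u x ^ (2 * r - 1) - b * (u x ^ (r - 1) * v x ^ r)) ∧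
      (∀ x, G x = b2 * v x ^ (2 * r - 1) - b * (v x ^ (r - 1) * u x ^ r)) := by
  have hr0 : 0 < r := by linarith
  obtain ⟨m, ⟨⟨u, v⟩, ⟨hu, hv⟩, ⟨nu, nv⟩, hJ⟩, hmin⟩ := sS_min hr hb1 hb2 b
  simp only at hu hv nu nv hJ
  have u0 : u ≠ 0 := by rintro rfl; simp at nu
  have v0 : v ≠ 0 := by rintro rfl; simp at nv
  have bd1 : BddAbove (Set.range fun n => en n u) := by
    refine ⟨2 * (m + b1 * iI r u / (2 * r)), ?_⟩
    rintro _ ⟨n, rfl⟩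
    have := hJ n 1 0 zero_le_one le_rfl
    rw [Jr_one_zero hr] at this
    simp only
    linarith
  have bd2 : BddAbove (Set.range fun n => en n v) := by
    refine ⟨2 * (m + b2 * iI r v / (2 * r)), ?_⟩
    rintro _ ⟨n, rfl⟩
    have := hJ n 0 1 le_rfl zero_le_one
    rw [Jr_swap, Jr_one_zero hr] at this
    simp only
    linarith
  have t1 := tendsto_atTop_ciSup (en_mono u) bd1
  have t2 := tendsto_atTop_ciSup (en_mono v) bd2
  have l1 : ∀ n, en n u ≤ ⨆ n, en n u := fun n => le_ciSup bd1 n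
  have l2 : ∀ n, en n v ≤ ⨆ n, en n v := fun n => le_ciSup bd2 n
  generalize (⨆ n, en n u) = a1 at *
  generalize (⨆ n, en n v) = a2 at *
  have a10 := (en_nonneg 0 u).trans (l1 0)
  have a20 := (en_nonneg 0 v).trans (l2 0)
  have hM : ∀ s t : ℝ, 0 ≤ s → 0 ≤ t → Jr r a1 a2 (b1 * iI r u) (b2 * iI r v) (b * iJ r u v) s t ≤ m := by
    intro s t hs ht
    refine le_of_tendsto (f := fun n => Jr r (en n u) (en n v) (b1 * iI r u) (b2 * iI r v) (b * iJ r u v) s t)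
      (x := atTop) ?_ (Eventually.of_forall fun n => hJ n s t hs ht)
    unfold Jr
    exact ((((t1.const_mul _).div_const _).add ((t2.const_mul _).div_const _))).sub_const _
  have c1 : a1 = 0 → ∀ x, u x = 1 := fun h => en_const hu nu (h ▸ l1)
  have c2 : a2 = 0 → ∀ x, v x = 1 := fun h => en_const hv nv (h ▸ l2)
  have iJp : ∀ u v : C(UnitAddCircle, ℝ), (∀ x, u x = 1) → v ≠ 0 → 0 < iJ r u v := by
    intro u v h hv
    refine lt_of_le_of_ne (iJ_nonneg r u v) fun h0 => hv ?_
    have hc : Continuous fun x => |v x| ^ r := pw_cont hr v.continuous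
    have h00 : (∫ x, |v x| ^ r) = 0 := by rw [h0]; simp [iJ, h]
    have h1 := (MeasureTheory.integral_eq_zero_iff_of_nonneg (fun x => by positivity) (ci_int hc)).1 h00
    have h2 := (Continuous.ae_eq_iff_eq MeasureTheory.volume hc continuous_const).1 h1
    ext x
    have h3 : |v x| ^ r = 0 := congrFun h2 x
    have := (Real.rpow_eq_zero (abs_nonneg _) (by linarith)).1 h3
    simpa using this
  have iI1 : ∀ u : C(UnitAddCircle, ℝ), (∀ x, u x = 1) → iI r u = 1 := by
    intro u h
    simp [iI, h]
  have iJ1 : ∀ u v : C(UnitAddCircle, ℝ), (∀ x, u x = 1) → (∀ x, v x = 1) → iJ r u v = 1 := by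
    intro u v h h'
    simp [iJ, h, h']
  obtain ⟨hdet, s, t, hs, ht, E1, E2⟩ := nr_exists hr a10 a20 (mul_pos hb1 (iI_pos hr u0)) (mul_pos hb2 (iI_pos hr v0))
    (mul_nonneg hb.le (iJ_nonneg r u v)) (fun h => mul_pos hb (iJp u v (c1 h) v0))
    (fun h => mul_pos hb (iJ_comm r v u ▸ iJp v u (c2 h) u0))
    (fun h h' => by rw [iI1 u (c1 h), iI1 v (c2 h'), iJ1 u v (c1 h) (c2 h')]; simpa using hbb) hM
  have m1 := hM s t hs.le ht.le
  have en1 : ∀ n, en n (s • u) ≤ s ^ 2 * a1 := fun n => by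
    rw [en_smul]; exact mul_le_mul_of_nonneg_left (l1 n) (sq_nonneg s)
  have en2 : ∀ n, en n (t • v) ≤ t ^ 2 * a2 := fun n => by
    rw [en_smul]; exact mul_le_mul_of_nonneg_left (l2 n) (sq_nonneg t)
  have i1 : b1 * iI r (s • u) = s ^ (2 * r) * (b1 * iI r u) := by rw [iI_smul hs.le]; ring
  have i2 : b2 * iI r (t • v) = t ^ (2 * r) * (b2 * iI r v) := by rw [iI_smul ht.le]; ring
  have i3 : b * iJ r (s • u) (t • v) = s ^ r * t ^ r * (b * iJ r u v) := by rw [iJ_smul hs.le ht.le]; ring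
  have U0 : s • u ≠ 0 := smul_ne_zero hs.ne' u0
  have V0 : t • v ≠ 0 := smul_ne_zero ht.ne' v0
  have hU : ∀ x, 0 ≤ (s • u) x := fun x => mul_nonneg hs.le (hu x)
  have hV : ∀ x, 0 ≤ (t • v) x := fun x => mul_nonneg ht.le (hv x)
  have E1' : s ^ 2 * a1 + b * iJ r (s • u) (t • v) = b1 * iI r (s • u) := by rw [i1, i3]; linarith
  have E2' : t ^ 2 * a2 + b * iJ r (s • u) (t • v) = b2 * iI r (t • v) := by rw [i2, i3]; linarith
  have hdet' : (b * iJ r (s • u) (t • v)) ^ 2 < (b1 * iI r (s • u)) * (b2 * iI r (t • v)) := by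
    rw [i1, i2, i3, nr_sq hs.le, nr_sq ht.le]
    have p1 : 0 < (s ^ r) ^ 2 * (t ^ r) ^ 2 := by positivity
    nlinarith
  have hm : (1 / 2 - 1 / (2 * r)) * (s ^ 2 * a1 + t ^ 2 * a2) ≤ m := by
    refine le_trans (le_of_eq ?_) m1
    unfold Jr
    have : b1 * iI r u * s ^ (2 * r) + b2 * iI r v * t ^ (2 * r) - 2 * (b * iJ r u v) * (s ^ r * t ^ r) = s ^ 2 * a1 + t ^ 2 * a2 := by
      linarith
    rw [this]; ring
  have E1s := E1'
  have E2s := E2'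
  have hds := hdet'
  rw [iJ_comm] at E1s E2s hds
  rw [mul_comm (b1 * _)] at hds
  obtain ⟨u1, F, d1, d2, hF⟩ := el_eq hr hb1 hb2 hb.le hU hV U0 V0 en1 en2 E1' E2' hdet' (fun c hc => hm.trans (hmin c hc))
  obtain ⟨v1, G, d3, d4, hG⟩ := el_eq hr hb2 hb1 hb.le hV hU V0 U0 en2 en1 E2s E1s hds
    (fun c hc => by rw [add_comm]; exact hm.trans (hmin c (sS_swap hc)))
  exact ⟨_, _, u1, v1, F, G, hU, hV, U0, d1, d2, d3, d4, hF, hG⟩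

theorem fz_lap_coord {N : ℕ} (k : Fin N) {g g1 g2 : ℝ → ℝ} (h1 : ∀ t, HasDerivAt g (g1 t) t) (h2 : ∀ t, HasDerivAt g1 (g2 t) t)
    (x : Fin N → ℝ) : laplacian (fun y => g (y k)) x = g2 (x k) := by
  have key : ∀ {g g1 : ℝ → ℝ}, (∀ t, HasDerivAt g (g1 t) t) → ∀ (y : Fin N → ℝ) (i : Fin N),
      fderiv ℝ (fun y : Fin N → ℝ => g (y k)) y (Pi.single i 1) = if i = k then g1 (y k) else 0 := by
    intro g g1 h y i
    have hp : HasFDerivAt (fun y : Fin N → ℝ => y k) (ContinuousLinearMap.proj (R := ℝ) (φ := fun _ : Fin N => ℝ) k) y := hasFDerivAt_apply k y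
    have := (h (y k)).comp_hasFDerivAt y hp
    have e := this.fderiv
    have e' : fderiv ℝ (fun y : Fin N → ℝ => g (y k)) y = g1 (y k) • ContinuousLinearMap.proj (R := ℝ) (φ := fun _ : Fin N => ℝ) k := e
    rw [e']
    simp [Pi.single_apply, eq_comm]
  unfold laplacian
  rw [Finset.sum_eq_single k]
  · simp only [key h1]
    simp only [if_true]
    rw [key h2, if_pos rfl]
  · intro i _ hik
    simp only [key h1, if_neg hik]
    simp
  · simp

theorem fz_contDiff {N : ℕ} (k : Fin N) {g g1 g2 : ℝ → ℝ} (h1 : ∀ t, HasDerivAt g (g1 t) t) (h2 : ∀ t, HasDerivAt g1 (g2 t) t)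
    (hc : Continuous g2) : ContDiff ℝ 2 (fun y : Fin N → ℝ => g (y k)) := by
  have e1 : deriv g = g1 := funext fun t => (h1 t).deriv
  have e2 : deriv g1 = g2 := funext fun t => (h2 t).deriv
  have c1 : ContDiff ℝ 1 g1 := contDiff_one_iff_deriv.2 ⟨fun t => (h2 t).differentiableAt, by rwa [e2]⟩
  have c2 : ContDiff ℝ (1 + 1) g := contDiff_succ_iff_deriv.2 ⟨fun t => (h1 t).differentiableAt, by simp, by rwa [e1]⟩
  have c3 : ContDiff ℝ 2 g := by
    have : (1 + 1 : WithTop ℕ∞) = 2 := by norm_num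
    rwa [this] at c2
  exact c3.comp (contDiff_apply ℝ ℝ k)

theorem fz_pow {r x : ℝ} (hr : 1 < r) (hx : 0 ≤ x) : x ^ (2 * r - 1) = x ^ r * x ^ (r - 1) := by
  rcases hx.eq_or_lt with rfl | h
  · rw [Real.zero_rpow (by linarith), Real.zero_rpow (by linarith : r ≠ 0), zero_mul]
  · rw [← Real.rpow_add h]; congr 1; ring

theorem fz_sys {N : ℕ} (k : Fin N) {p : ℝ} (hp : 2 < p) (B : Matrix (Fin 2) (Fin 2) ℝ) (hsym : B.IsSymm)
    (h0 : 0 < B 0 0) (h1 : 0 < B 1 1) (hb : B 0 1 < 0) (hbb : B 0 0 * B 1 1 < (B 0 1) ^ 2) :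
    ∃ u : Fin 2 → (Fin N → ℝ) → ℝ,
      (∀ i, ContDiff ℝ 2 (u i)) ∧
      (∀ i x, 0 ≤ u i x) ∧
      (∀ i x, -laplacian (u i) x =
        ∑ j, B i j * (u j x) ^ (p / 2) * (u i x) ^ (p / 2 - 1)) ∧
      (∃ i, u i ≠ 0) := by
  have hr : 1 < p / 2 := by linarith
  have hs : B 1 0 = B 0 1 := hsym.apply 0 1
  obtain ⟨u, v, u1, v1, F, G, hu, hv, hu0, d1, d2, d3, d4, hF, hG⟩ :=
    el_main hr h0 h1 (neg_pos.2 hb) (by rwa [neg_sq])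
  refine ⟨![fun y => u ((y k : ℝ) : UnitAddCircle), fun y => v ((y k : ℝ) : UnitAddCircle)], ?_, ?_, ?_, 0, ?_⟩
  · intro i
    fin_cases i
    · exact fz_contDiff k d1 d2 ((-F).continuous.comp coe_cont)
    · exact fz_contDiff k d3 d4 ((-G).continuous.comp coe_cont)
  · intro i x
    fin_cases i
    · exact hu _
    · exact hv _
  · intro i x
    fin_cases i
    · have := fz_lap_coord k d1 d2 x
      simp only [Fin.zero_eta, Matrix.cons_val_zero, Fin.sum_univ_two, Matrix.cons_val_one]
      rw [this, ContinuousMap.neg_apply, neg_neg, hF, fz_pow hr (hu _)]; ring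
    · have := fz_lap_coord k d3 d4 x
      simp only [Fin.mk_one, Matrix.cons_val_zero, Fin.sum_univ_two, Matrix.cons_val_one]
      rw [this, ContinuousMap.neg_apply, neg_neg, hG, fz_pow hr (hv _), hs]; ring
  · intro h
    refine hu0 ?_
    ext z
    obtain ⟨t, rfl⟩ := QuotientAddGroup.mk_surjective z
    exact congrFun h (fun _ => t)

theorem fz_const {N : ℕ} (p : ℝ) (B : Matrix (Fin 2) (Fin 2) ℝ) (c : Fin 2 → ℝ) (hc : ∀ i, 0 ≤ c i) (hne : ∃ i, c i ≠ 0)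
    (h : ∀ i, 0 = ∑ j, B i j * (c j) ^ (p / 2) * (c i) ^ (p / 2 - 1)) :
    ∃ u : Fin 2 → (Fin N → ℝ) → ℝ,
      (∀ i, ContDiff ℝ 2 (u i)) ∧
      (∀ i x, 0 ≤ u i x) ∧
      (∀ i x, -laplacian (u i) x =
        ∑ j, B i j * (u j x) ^ (p / 2) * (u i x) ^ (p / 2 - 1)) ∧
      (∃ i, u i ≠ 0) := by
  refine ⟨fun i _ => c i, fun i => contDiff_const, fun i _ => hc i, fun i x => ?_, ?_⟩
  · rw [← h i]; simp [laplacian]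
  · obtain ⟨i, hi⟩ := hne
    exact ⟨i, fun h => hi (congrFun h 0)⟩

theorem stmt_12 (N : ℕ) (hN1 : 1 ≤ N) (p : ℝ) (hp : 2 < p)
    (hpN : 3 ≤ N → p ≤ (2 * N - 2) / (N - 2))
    (B : Matrix (Fin 2) (Fin 2) ℝ) (hsym : B.IsSymm)
    (hdiag : 0 ≤ B 0 0 ∧ 0 ≤ B 1 1) :
    (∃ u : Fin 2 → (Fin N → ℝ) → ℝ,
      (∀ i, ContDiff ℝ 2 (u i)) ∧
      (∀ i x, 0 ≤ u i x) ∧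
      (∀ i x, -laplacian (u i) x =
        ∑ j, B i j * (u j x) ^ (p / 2) * (u i x) ^ (p / 2 - 1)) ∧
      (∃ i, u i ≠ 0)) ↔
    ¬ (0 < B 0 0 ∧ 0 < B 1 1 ∧ -Real.sqrt (B 0 0 * B 1 1) < B 0 1) := by
  constructor
  · rintro ⟨u, h1, h2, h3, i, hi⟩ hB
    exact hi (lv_nonexist N p hp hpN B hsym hB u h1 h2 h3 i)
  · intro hB
    have hs : B 1 0 = B 0 1 := hsym.apply 0 1
    have z1 : (0:ℝ) ^ (p / 2) = 0 := Real.zero_rpow (by linarith)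
    have z2 : (0:ℝ) ^ (p / 2 - 1) = 0 := Real.zero_rpow (by linarith)
    rcases hdiag.1.eq_or_lt with h0 | h0
    · refine fz_const p B ![1, 0] (fun i => by fin_cases i <;> simp) ⟨0, by simp⟩ fun i => ?_
      fin_cases i <;> simp [Fin.sum_univ_two, z1, z2, ← h0]
    rcases hdiag.2.eq_or_lt with h1 | h1
    · refine fz_const p B ![0, 1] (fun i => by fin_cases i <;> simp) ⟨1, by simp⟩ fun i => ?_
      fin_cases i <;> simp [Fin.sum_univ_two, z1, z2, ← h1]
    have h2 : B 0 1 ≤ -Real.sqrt (B 0 0 * B 1 1) := by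
      by_contra h
      exact hB ⟨h0, h1, not_le.1 h⟩
    have hsp : 0 < Real.sqrt (B 0 0 * B 1 1) := Real.sqrt_pos.2 (mul_pos h0 h1)
    have hsq : Real.sqrt (B 0 0 * B 1 1) ^ 2 = B 0 0 * B 1 1 := Real.sq_sqrt (mul_pos h0 h1).le
    rcases h2.eq_or_lt with h2 | h2
    · have pw : ∀ y : ℝ, 0 ≤ y → (y ^ (2 / p)) ^ (p / 2) = y := by
        intro y hy
        rw [← Real.rpow_mul hy, show 2 / p * (p / 2) = 1 by field_simp, Real.rpow_one]
      refine fz_const p B ![(Real.sqrt (B 1 1)) ^ (2 / p), (Real.sqrt (B 0 0)) ^ (2 / p)]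
        (fun i => by fin_cases i <;> simp <;> positivity) ⟨0, ?_⟩ fun i => ?_
      · simp only [Matrix.cons_val_zero]
        exact (Real.rpow_pos_of_pos (Real.sqrt_pos.2 h1) _).ne'
      · have q0 := Real.sq_sqrt h0.le
        have q1 := Real.sq_sqrt h1.le
        have e : B 0 1 = -(Real.sqrt (B 0 0) * Real.sqrt (B 1 1)) := by rw [h2, Real.sqrt_mul h0.le]
        have e0 : B 0 0 * Real.sqrt (B 1 1) + B 0 1 * Real.sqrt (B 0 0) = 0 := by
          rw [e]; linear_combination (-Real.sqrt (B 1 1)) * q0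
        have e1 : B 0 1 * Real.sqrt (B 1 1) + B 1 1 * Real.sqrt (B 0 0) = 0 := by
          rw [e]; linear_combination (-Real.sqrt (B 0 0)) * q1
        fin_cases i
        · simp only [Fin.zero_eta, Matrix.cons_val_zero, Fin.sum_univ_two, Matrix.cons_val_one]
          rw [pw _ (Real.sqrt_nonneg _), pw _ (Real.sqrt_nonneg _), ← add_mul, e0, zero_mul]
        · simp only [Fin.mk_one, Matrix.cons_val_zero, Fin.sum_univ_two, Matrix.cons_val_one]
          rw [pw _ (Real.sqrt_nonneg _), pw _ (Real.sqrt_nonneg _), hs, ← add_mul, e1, zero_mul]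
    · exact fz_sys ⟨0, by omega⟩ hp B hsym h0 h1 (by linarith) (by nlinarith)
end

section
/- For ε > 0 let B_ε be the symmetric 3×3 matrix with rows (1, −1+ε, −1+ε), (−1+ε, 1, 1), (−1+ε, 1, 1). Then there exists ε₀ > 0 such that for every ε with 0 < ε < ε₀, the matrix B_ε is NOT strictly cubically copositive; equivalently, there is no sequence of positive numbers ε_k → 0 such that B_{ε_k} is strictly cubically copositive for all k. -/
open Finset

theorem stmt_16 :
    ∃ ε₀ > (0 : ℝ), ∀ ε : ℝ, 0 < ε → ε < ε₀ →
      ¬ (∃ μ : Fin 3 → ℝ, (∀ i, 0 ≤ μ i) ∧ ∀ c : Fin 3 → ℝ, (∀ i, 0 ≤ c i) → c ≠ 0 →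
        0 < ∑ i, ∑ j,
          (!![(1 : ℝ), -1 + ε, -1 + ε; -1 + ε, 1, 1; -1 + ε, 1, 1]) i j * c j ^ 2 * c i * μ i) := by
  refine ⟨1/1000, by norm_num, ?_⟩
  rintro ε h0 h1 ⟨μ, hμ, h⟩
  have key : ∀ x y z : ℝ, 0 < x → 0 ≤ y → 0 ≤ z →
      0 < x * (x^2 + (-1+ε) * (y^2+z^2)) * μ 0 + (y * μ 1 + z * μ 2) * ((-1+ε)*x^2+y^2+z^2) := by
    intro x y z hx hy hz
    have := h ![x, y, z] (by intro i; fin_cases i <;> simp [hx.le, hy, hz])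
      (by intro hc; have := congrFun hc 0; simp at this; exact hx.ne' this)
    simp [Fin.sum_univ_three] at this
    linarith
  have k1 := key (17/10) 1 1 (by norm_num) (by norm_num) (by norm_num)
  have k2 := key (9/10) 1 0 (by norm_num) (by norm_num) (by norm_num)
  have k3 := key (9/10) 0 1 (by norm_num) (by norm_num) (by norm_num)
  have e : ∀ i, ε * μ i ≤ 1/1000 * μ i := fun i => mul_le_mul_of_nonneg_right h1.le (hμ i)
  have a0 := e 0
  have a1 := e 1
  have a2 := e 2
  have b0 := hμ 0
  have b1 := hμ 1
  have b2 := hμ 2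
  linarith
end

section
/- Let B = (β_ij) be a symmetric n×n real matrix which is NOT strictly copositive, such that Bc ≠ 0 for every c ∈ C⁺ₙ with c ≠ 0, and such that ∑_{i,j=1}^n β_ij c_i c_j > 0 for every nonzero c in the boundary of the cone, ∂C⁺ₙ = {c ∈ C⁺ₙ : c_i = 0 for some i}. Then there exists a vector d in the interior of C⁺ₙ (i.e. with all components strictly positive) such that ∑_{i,j=1}^n β_ij d_i d_j < 0. -/
open Finset

theorem stmt_19 (n : ℕ) (B : Matrix (Fin n) (Fin n) ℝ) (hsym : B.IsSymm)
    (hncop : ¬ (∀ c : Fin n → ℝ, (∀ i, 0 ≤ c i) → c ≠ 0 → 0 < ∑ i, ∑ j, B i j * c i * c j))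
    (hker : ∀ c : Fin n → ℝ, (∀ i, 0 ≤ c i) → c ≠ 0 → B.mulVec c ≠ 0)
    (hbdry : ∀ c : Fin n → ℝ, (∀ i, 0 ≤ c i) → c ≠ 0 → (∃ i, c i = 0) →
      0 < ∑ i, ∑ j, B i j * c i * c j) :
    ∃ d : Fin n → ℝ, (∀ i, 0 < d i) ∧ ∑ i, ∑ j, B i j * d i * d j < 0 := by
  have hQ : ∀ c : Fin n → ℝ, ∑ i, ∑ j, B i j * c i * c j = c ⬝ᵥ B.mulVec c := by
    intro c
    simp only [dotProduct, Matrix.mulVec, Finset.mul_sum]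
    refine Finset.sum_congr rfl fun i _ => Finset.sum_congr rfl fun j _ => by ring
  push Not at hncop
  obtain ⟨c, hc, hc0, hle⟩ := hncop
  have hpos : ∀ i, 0 < c i := fun i =>
    lt_of_le_of_ne (hc i) fun h => absurd (hbdry c hc hc0 ⟨i, h.symm⟩) (not_lt.mpr hle)
  rcases hle.lt_or_eq with hlt | heq
  · exact ⟨c, hpos, hlt⟩
  obtain ⟨k, hk⟩ := Function.ne_iff.mp (hker c hc hc0)
  rw [hQ] at heq
  set g := B.mulVec c k with hg
  have hk' : g ≠ 0 := hk
  have hck := hpos k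
  have hexp : ∀ t : ℝ, (c + Pi.single k t) ⬝ᵥ B.mulVec (c + Pi.single k t)
      = 2 * t * g + t ^ 2 * B k k := by
    intro t
    have h1 : c ⬝ᵥ B.mulVec (Pi.single k t) = t * g := by
      rw [Matrix.dotProduct_mulVec, ← Matrix.mulVec_transpose, hsym.eq, dotProduct_single]
      ring
    have h2 : B.mulVec (Pi.single k t) k = B k k * t := by
      simp [Matrix.mulVec, dotProduct_single]
    rw [Matrix.mulVec_add, add_dotProduct, dotProduct_add, dotProduct_add, heq, h1,
      single_dotProduct, single_dotProduct, h2]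
    ring
  have hden : 0 < 1 + |B k k| + |g| / c k := by positivity
  obtain ⟨s, hs⟩ : ∃ s, s = 1 / (1 + |B k k| + |g| / c k) := ⟨_, rfl⟩
  have hs0 : 0 < s := by rw [hs]; positivity
  have hs1 : s * (1 + |B k k| + |g| / c k) = 1 := by rw [hs]; field_simp
  have hq : 0 ≤ |g| / c k := by positivity
  have hb := abs_nonneg (B k k)
  have hsB : s * B k k < 2 := by nlinarith [le_abs_self (B k k), mul_nonneg hs0.le hq]
  have hsg : s * g < c k := by
    have h1 : s * (|g| / c k) < 1 := by nlinarith [mul_nonneg hs0.le hb]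
    have h2 : s * |g| < c k := by
      rwa [← mul_div_assoc, div_lt_one hck] at h1
    nlinarith [le_abs_self g]
  refine ⟨c + Pi.single k (-(s * g)), fun i => ?_, ?_⟩
  · by_cases h : i = k
    · subst h; simp; exact hsg
    · simp [h, hpos i]
  · rw [hQ, hexp]
    have hg2 : 0 < s * g ^ 2 := by positivity
    nlinarith [mul_pos hg2 (sub_pos.mpr hsB)]
end
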